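/- arXiv:math/0006139 — 8 statements merged into one kernel-verified Lean document; each statement's English description precedes it below -/
import Mathlib

section
/- Let X be a simplicial complex on [n] and let a, b ⊆ [n] be disjoint subsets. Then the image of the map Φ : M_{a−b} → X, Φ(p) = (p ∪ a) ∖ b, is exactly N_{a−b}; in particular Φ is a surjection from M_{a−b} onto N_{a−b}. -/
/-- A simplicial complex on `[n] = {0,…,n}`: a collection of subsets of `[n]`
closed under taking subsets, containing `∅`. -/
def IsSimplicialComplex {n : ℕ} (S : Set (Finset (Fin (n+1)))) : Prop :=
  ∅ ∈ S ∧ ∀ f ∈ S, ∀ g ⊆ f, g ∈ S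

/-- `M_{a−b} = {p ⊆ [n] : p ∉ X and (p ∪ a) ∖ b ∈ X}`. -/
def Mab {n : ℕ} (S : Set (Finset (Fin (n+1)))) (a b : Finset (Fin (n+1))) :
    Set (Finset (Fin (n+1))) :=
  {p | p ∉ S ∧ (p ∪ a) \ b ∈ S}

/-- `N_{a−b} = {f ∈ X : a ⊆ f, f ∩ b = ∅, f ∪ b ∉ X}`. -/
def Nab {n : ℕ} (S : Set (Finset (Fin (n+1)))) (a b : Finset (Fin (n+1))) :
    Set (Finset (Fin (n+1))) :=
  {f | f ∈ S ∧ a ⊆ f ∧ f ∩ b = ∅ ∧ f ∪ b ∉ S}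

/-- the image of `Φ : M_{a−b} → X`, `Φ(p) = (p ∪ a) ∖ b`, is exactly
`N_{a−b}`; in particular `Φ` is a surjection from `M_{a−b}` onto `N_{a−b}`. -/
theorem image_Phi_eq_Nab {n : ℕ} (S : Set (Finset (Fin (n+1))))
    (hS : IsSimplicialComplex S) (a b : Finset (Fin (n+1))) (hab : Disjoint a b) :
    (fun p => (p ∪ a) \ b) '' Mab S a b = Nab S a b := by
  ext f
  constructor
  · rintro ⟨p, ⟨hp, hpS⟩, rfl⟩
    refine ⟨hpS, ?_, Finset.sdiff_inter_self b (p ∪ a), fun h => hp (hS.2 _ h p ?_)⟩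
    · exact Finset.subset_sdiff.2 ⟨Finset.subset_union_right, hab⟩
    · rw [Finset.sdiff_union_self_eq_union]
      exact Finset.subset_union_left.trans Finset.subset_union_left
  · rintro ⟨hf, haf, hfb, hfbS⟩
    have key : (f ∪ b ∪ a) \ b = f := by
      rw [Finset.union_right_comm, Finset.union_eq_left.2 haf, Finset.union_sdiff_right,
        Finset.sdiff_eq_self_of_disjoint (Finset.disjoint_iff_inter_eq_empty.2 hfb)]
    exact ⟨f ∪ b, ⟨hfbS, key.symm ▸ hf⟩, key⟩
end

section
/- Let X be a simplicial complex on [n], let a, b ⊆ [n] be disjoint, and let f ∈ N_{a−b}. Then f has a preimage under Φ that does not contain b (i.e., there exists p ∈ M_{a−b} with (p ∪ a) ∖ b = f and b ⊄ p) if and only if f ∈ Ñ_{a−b}. -/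
/-- `Ñ_{a−b} = {f ∈ N_{a−b} : f ∪ b′ ∉ X for some proper subset b′ ⊊ b}`. -/
def Ntilde {n : ℕ} (S : Set (Finset (Fin (n+1)))) (a b : Finset (Fin (n+1))) :
    Set (Finset (Fin (n+1))) :=
  {f | f ∈ Nab S a b ∧ ∃ b' ⊂ b, f ∪ b' ∉ S}

/-- `f ∈ N_{a−b}` has a preimage under `Φ` not containing `b`
iff `f ∈ Ñ_{a−b}`. -/
theorem preimage_not_containing_b_iff_Ntilde {n : ℕ} (S : Set (Finset (Fin (n+1))))
    (hS : IsSimplicialComplex S) (a b : Finset (Fin (n+1))) (hab : Disjoint a b)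
    (f : Finset (Fin (n+1))) (hf : f ∈ Nab S a b) :
    (∃ p ∈ Mab S a b, (p ∪ a) \ b = f ∧ ¬ b ⊆ p) ↔ f ∈ Ntilde S a b := by
  obtain ⟨-, hdown⟩ := hS
  obtain ⟨hfS, haf, hfb, -⟩ := id hf
  have hdisj : ∀ x ∈ f, x ∉ b :=
    Finset.disjoint_left.mp (Finset.disjoint_iff_inter_eq_empty.mpr hfb)
  constructor
  · rintro ⟨p, ⟨hpS, -⟩, hpf, hbp⟩
    refine ⟨hf, p ∩ b, Finset.ssubset_iff_subset_ne.mpr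
      ⟨Finset.inter_subset_right, fun h => hbp (Finset.inter_eq_right.mp h)⟩, fun h => hpS ?_⟩
    refine hdown _ h p fun x hx => ?_
    rw [← hpf]
    by_cases hxb : x ∈ b <;> simp [hx, hxb]
  · rintro ⟨-, b', hb', hfb'⟩
    have himage : ((f ∪ b') ∪ a) \ b = f := by
      ext x
      have h₁ := hdisj x
      have h₂ := @haf x
      have h₃ : x ∈ b' → x ∈ b := fun hx => hb'.subset hx
      simp only [Finset.mem_sdiff, Finset.mem_union]
      tauto
    refine ⟨f ∪ b', ⟨hfb', himage.symm ▸ hfS⟩, himage, fun h => hb'.not_subset fun x hx => ?_⟩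
    exact (Finset.mem_union.mp (h hx)).resolve_left fun hxf => hdisj x hxf hx
end

section
/- Let X be a simplicial complex on [n] and let a, b ⊆ [n] be disjoint. If (p, q) ∈ M^{(2)}_{a−b}, then (Φ(p), Φ(q)) ∈ N^{(2)}_{a−b}, and the induced map M^{(2)}_{a−b} → N^{(2)}_{a−b}, (p,q) ↦ (Φ(p), Φ(q)), is surjective. -/
/-- `M^{(2)}_{a−b} = {(p,q) : p, q ∈ M_{a−b}, (p ∪ q ∪ a) ∖ b ∈ X}`. -/
def M2 {n : ℕ} (S : Set (Finset (Fin (n+1)))) (a b : Finset (Fin (n+1))) :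
    Set (Finset (Fin (n+1)) × Finset (Fin (n+1))) :=
  {pq | pq.1 ∈ Mab S a b ∧ pq.2 ∈ Mab S a b ∧ (pq.1 ∪ pq.2 ∪ a) \ b ∈ S}

/-- `N^{(2)}_{a−b} = {(f,g) : f, g ∈ N_{a−b}, f ∪ g ∈ X}`. -/
def N2 {n : ℕ} (S : Set (Finset (Fin (n+1)))) (a b : Finset (Fin (n+1))) :
    Set (Finset (Fin (n+1)) × Finset (Fin (n+1))) :=
  {fg | fg.1 ∈ Nab S a b ∧ fg.2 ∈ Nab S a b ∧ fg.1 ∪ fg.2 ∈ S}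

/-- `(p,q) ∈ M^{(2)}_{a−b}` implies `(Φ(p), Φ(q)) ∈ N^{(2)}_{a−b}`, and
the induced map `M^{(2)}_{a−b} → N^{(2)}_{a−b}` is surjective. -/
theorem Phi_pairs_maps_onto_N2 {n : ℕ} (S : Set (Finset (Fin (n+1))))
    (hS : IsSimplicialComplex S) (a b : Finset (Fin (n+1))) (hab : Disjoint a b) :
    (∀ pq ∈ M2 S a b, ((pq.1 ∪ a) \ b, (pq.2 ∪ a) \ b) ∈ N2 S a b) ∧
    Set.SurjOn (fun pq : Finset (Fin (n+1)) × Finset (Fin (n+1)) =>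
      ((pq.1 ∪ a) \ b, (pq.2 ∪ a) \ b)) (M2 S a b) (N2 S a b) := by
  have maps : ∀ p ∈ Mab S a b, (p ∪ a) \ b ∈ Nab S a b := fun p hp =>
    ⟨hp.2, by grind [Finset.disjoint_left], by grind,
      fun h => hp.1 (hS.2 _ h _ (by grind))⟩
  have restore : ∀ f ∈ Nab S a b, (f ∪ b ∪ a) \ b = f := by
    rintro f ⟨-, haf, hfb, -⟩
    rw [Finset.union_right_comm, Finset.union_eq_left.2 haf, Finset.union_sdiff_right,
      Finset.sdiff_eq_self_of_disjoint (Finset.disjoint_iff_inter_eq_empty.2 hfb)]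
  have lift : ∀ f ∈ Nab S a b, f ∪ b ∈ Mab S a b := fun f hf =>
    ⟨hf.2.2.2, (restore f hf).symm ▸ hf.1⟩
  refine ⟨?_, ?_⟩
  · rintro ⟨p, q⟩ ⟨hp, hq, hpq⟩
    exact ⟨maps p hp, maps q hq, hS.2 _ hpq _ (by grind)⟩
  · rintro ⟨f, g⟩ ⟨hf, hg, hfg⟩
    refine ⟨(f ∪ b, g ∪ b), ⟨lift f hf, lift g hg, hS.2 _ hfg _ ?_⟩,
      Prod.ext (restore f hf) (restore g hg)⟩
    have haf := hf.2.1
    grind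
end

section
/- Let X be a simplicial complex on [n]. Let 𝐚, 𝐚′ ∈ ℕ^{n+1} have the same support a ⊆ [n], let b ⊆ [n] with a ∩ b = ∅, and let 𝐛 ∈ {0,1}^{n+1} be the characteristic vector of b. Then Hom(I_X, A_X)_{𝐚−𝐛} and Hom(I_X, A_X)_{𝐚′−𝐛} are isomorphic as ℂ-vector spaces; i.e., the homogeneous pieces of Hom_P(I_X, A_X) depend only on the supports a and b. -/
open MvPolynomial

/-- The squarefree monomial `x^p = ∏_{i ∈ p} x_i`. -/
noncomputable def xmon {n : ℕ} (p : Finset (Fin (n+1))) : MvPolynomial (Fin (n+1)) ℂ :=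
  ∏ i ∈ p, X i

/-- The monomial `x^e` for an exponent vector `e ∈ ℕ^{n+1}`. -/
noncomputable def emon {n : ℕ} (e : Fin (n+1) → ℕ) : MvPolynomial (Fin (n+1)) ℂ :=
  monomial (Finsupp.equivFunOnFinite.symm e) 1

/-- The Stanley–Reisner ideal `I_X = (x^p : p ∉ X)`. -/
noncomputable def SRideal {n : ℕ} (S : Set (Finset (Fin (n+1)))) : Ideal (MvPolynomial (Fin (n+1)) ℂ) :=
  Ideal.span {q | ∃ p : Finset (Fin (n+1)), p ∉ S ∧ q = xmon p}

lemma xmon_mem_SRideal {n : ℕ} (S : Set (Finset (Fin (n+1))))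
    {p : Finset (Fin (n+1))} (hp : p ∉ S) : xmon p ∈ SRideal S :=
  Ideal.subset_span ⟨p, hp, rfl⟩

/-- The characteristic vector of `p ⊆ [n]`. -/
def charVec {n : ℕ} (p : Finset (Fin (n+1))) : Fin (n+1) → ℕ :=
  fun i => if i ∈ p then 1 else 0

/-- The degree `𝐜 = 𝐚 − 𝐛 ∈ ℤ^{n+1}` where `𝐛` is the characteristic vector of `b`. -/
def degC {n : ℕ} (A : Fin (n+1) → ℕ) (b : Finset (Fin (n+1))) : Fin (n+1) → ℤ :=
  fun i => (A i : ℤ) - (charVec b i : ℤ)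

/-- The shifted exponent `𝐩 + 𝐜` (as a vector of naturals, when nonnegative). -/
def shiftExp {n : ℕ} (p : Finset (Fin (n+1))) (c : Fin (n+1) → ℤ) : Fin (n+1) → ℕ :=
  fun i => ((charVec p i : ℤ) + c i).toNat

/-- A `P`-module homomorphism `φ : I_X → A_X` is homogeneous of degree `𝐜`:
for every non-face `p`, `φ(x^p)` is a scalar multiple of `π(x^{𝐩+𝐜})` when
`𝐩 + 𝐜 ∈ ℕ^{n+1}`, and `φ(x^p) = 0` otherwise. -/
def IsHomOfDeg {n : ℕ} (S : Set (Finset (Fin (n+1))))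
    (φ : SRideal S →ₗ[MvPolynomial (Fin (n+1)) ℂ] (MvPolynomial (Fin (n+1)) ℂ ⧸ SRideal S))
    (c : Fin (n+1) → ℤ) : Prop :=
  ∀ (p : Finset (Fin (n+1))) (hp : p ∉ S),
    ((∀ i, 0 ≤ (charVec p i : ℤ) + c i) →
      ∃ μ : ℂ, φ ⟨xmon p, xmon_mem_SRideal S hp⟩ =
        Ideal.Quotient.mk (SRideal S) (C μ * emon (shiftExp p c))) ∧
    (¬ (∀ i, 0 ≤ (charVec p i : ℤ) + c i) →
      φ ⟨xmon p, xmon_mem_SRideal S hp⟩ = 0)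

/-- The support of a vector `𝐚 ∈ ℕ^{n+1}`. -/
def suppV {n : ℕ} (A : Fin (n+1) → ℕ) : Finset (Fin (n+1)) :=
  Finset.univ.filter (fun i => A i ≠ 0)

section Transfer

variable {R M N : Type*} [CommRing R] [AddCommGroup M] [Module R M] [AddCommGroup N] [Module R N]

/-- Two endomorphisms with the same kernel have isomorphic ranges, via `f y ↦ g y`; composing with
this isomorphism turns a map with values in `range f` into one with values in `range g`. -/
noncomputable def rangeTransfer (f g : N →ₗ[R] N) (h : LinearMap.ker f = LinearMap.ker g)
    (φ : M →ₗ[R] N) (hφ : ∀ x, φ x ∈ LinearMap.range f) : M →ₗ[R] N :=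
  (LinearMap.range g).subtype ∘ₗ
    (f.quotKerEquivRange.symm ≪≫ₗ Submodule.quotEquivOfEq _ _ h ≪≫ₗ
      g.quotKerEquivRange).toLinearMap ∘ₗ φ.codRestrict (LinearMap.range f) hφ

lemma rangeTransfer_apply {f g : N →ₗ[R] N} (h : LinearMap.ker f = LinearMap.ker g)
    {φ : M →ₗ[R] N} (hφ : ∀ x, φ x ∈ LinearMap.range f) {x : M} {y : N} (hxy : φ x = f y) :
    rangeTransfer f g h φ hφ x = g y := by
  have hx : φ.codRestrict (LinearMap.range f) hφ x =
      f.quotKerEquivRange (Submodule.Quotient.mk y) := Subtype.ext hxy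
  simp only [rangeTransfer, LinearMap.comp_apply, LinearEquiv.coe_coe, hx,
    LinearEquiv.trans_apply, LinearEquiv.symm_apply_apply]
  rfl

end Transfer

section StanleyReisner

variable {n : ℕ}

lemma xmon_eq_monomial (p : Finset (Fin (n+1))) :
    xmon p = monomial (Finsupp.equivFunOnFinite.symm (charVec p)) 1 := by
  rw [monomial_eq, Finsupp.prod_fintype _ _ (by simp)]
  simp [xmon, charVec, Finset.prod_ite_mem]

lemma mem_SRideal_iff {S : Set (Finset (Fin (n+1)))} {f : MvPolynomial (Fin (n+1)) ℂ} :
    f ∈ SRideal S ↔ ∀ e ∈ f.support, ∃ p ∉ S, ∀ i ∈ p, e i ≠ 0 := by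
  have hspan : SRideal S = Ideal.span ((fun s => monomial s (1 : ℂ)) ''
      ((fun p => Finsupp.equivFunOnFinite.symm (charVec p)) '' Sᶜ)) := by
    rw [SRideal, Set.image_image]
    congr 1
    ext q
    simp only [Set.mem_ofPred_eq, Set.mem_image, Set.mem_compl_iff, ← xmon_eq_monomial, eq_comm]
  rw [hspan, mem_ideal_span_monomial_image]
  simp only [Set.exists_mem_image, Set.mem_compl_iff]
  refine forall₂_congr fun e _ => exists_congr fun p => and_congr_right fun _ => ?_
  rw [Finsupp.le_def]
  refine forall_congr' fun i => ?_
  by_cases hi : i ∈ p <;> simp [charVec, hi, Nat.one_le_iff_ne_zero]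

lemma emon_mul_mem_SRideal {S : Set (Finset (Fin (n+1)))} {A A' : Fin (n+1) → ℕ}
    (hsupp : ∀ i, A i ≠ 0 → A' i ≠ 0) {f : MvPolynomial (Fin (n+1)) ℂ}
    (hf : emon A * f ∈ SRideal S) : emon A' * f ∈ SRideal S := by
  classical
  rw [mem_SRideal_iff] at hf ⊢
  intro e he
  rw [mem_support_iff, emon, coeff_monomial_mul'] at he
  obtain ⟨hle, hne⟩ : Finsupp.equivFunOnFinite.symm A' ≤ e ∧
      coeff (e - Finsupp.equivFunOnFinite.symm A') f ≠ 0 := by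
    simpa using he
  obtain ⟨p, hp, hpe⟩ := hf (Finsupp.equivFunOnFinite.symm A +
      (e - Finsupp.equivFunOnFinite.symm A')) (by
    rw [mem_support_iff, emon, coeff_monomial_mul]
    simpa using hne)
  refine ⟨p, hp, fun i hi => ?_⟩
  have h1 := hpe i hi
  have h2 := hsupp i
  have h3 := hle i
  simp only [Finsupp.add_apply, Finsupp.tsub_apply, Finsupp.equivFunOnFinite_symm_apply_apply]
    at h1 h3
  omega

/-- Multiplication by `x^A` on the Stanley–Reisner ring. -/
noncomputable def mulEmon (S : Set (Finset (Fin (n+1)))) (A : Fin (n+1) → ℕ) :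
    (MvPolynomial (Fin (n+1)) ℂ ⧸ SRideal S) →ₗ[MvPolynomial (Fin (n+1)) ℂ]
      (MvPolynomial (Fin (n+1)) ℂ ⧸ SRideal S) :=
  LinearMap.lsmul _ _ (emon A)

lemma mulEmon_mk (S : Set (Finset (Fin (n+1)))) (A : Fin (n+1) → ℕ)
    (f : MvPolynomial (Fin (n+1)) ℂ) :
    mulEmon S A (Ideal.Quotient.mk _ f) = Ideal.Quotient.mk _ (emon A * f) :=
  rfl

lemma ker_mulEmon_le (S : Set (Finset (Fin (n+1)))) {A A' : Fin (n+1) → ℕ}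
    (hsupp : ∀ i, A i ≠ 0 → A' i ≠ 0) :
    LinearMap.ker (mulEmon S A) ≤ LinearMap.ker (mulEmon S A') := by
  intro y hy
  obtain ⟨f, rfl⟩ := Ideal.Quotient.mk_surjective y
  rw [LinearMap.mem_ker, mulEmon_mk, Ideal.Quotient.eq_zero_iff_mem] at hy ⊢
  exact emon_mul_mem_SRideal hsupp hy

lemma ker_mulEmon_eq (S : Set (Finset (Fin (n+1)))) {A A' : Fin (n+1) → ℕ}
    (hsupp : ∀ i, A i ≠ 0 ↔ A' i ≠ 0) :
    LinearMap.ker (mulEmon S A) = LinearMap.ker (mulEmon S A') :=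
  le_antisymm (ker_mulEmon_le S fun i => (hsupp i).1) (ker_mulEmon_le S fun i => (hsupp i).2)

lemma charVec_add_degC_nonneg_iff {A : Fin (n+1) → ℕ} {b : Finset (Fin (n+1))}
    (hdisj : ∀ i ∈ b, A i = 0) (p : Finset (Fin (n+1))) :
    (∀ i, 0 ≤ (charVec p i : ℤ) + degC A b i) ↔ b ⊆ p := by
  refine forall_congr' fun i => ?_
  have := hdisj i
  by_cases hb : i ∈ b <;> by_cases hp : i ∈ p <;> simp_all [charVec, degC]
  positivity

lemma emon_shiftExp {A : Fin (n+1) → ℕ} {b p : Finset (Fin (n+1))} (hbp : b ⊆ p) :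
    emon (shiftExp p (degC A b)) = emon A * xmon (p \ b) := by
  rw [xmon_eq_monomial, emon, emon, monomial_mul, one_mul]
  refine congrArg (fun e => monomial e 1) (Finsupp.ext fun i => ?_)
  have := @hbp i
  by_cases hb : i ∈ b <;> by_cases hp : i ∈ p <;> simp_all [charVec, degC, shiftExp]
  omega

/-- Homogeneity of degree `𝐚 − 𝐛`, expressed through multiplication by `x^𝐚`. -/
lemma isHomOfDeg_iff {S : Set (Finset (Fin (n+1)))} {A : Fin (n+1) → ℕ}
    {b : Finset (Fin (n+1))} (hdisj : ∀ i ∈ b, A i = 0)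
    (φ : SRideal S →ₗ[MvPolynomial (Fin (n+1)) ℂ] (MvPolynomial (Fin (n+1)) ℂ ⧸ SRideal S)) :
    IsHomOfDeg S φ (degC A b) ↔ ∀ (p : Finset (Fin (n+1))) (hp : p ∉ S),
      (b ⊆ p → ∃ μ : ℂ, φ ⟨xmon p, xmon_mem_SRideal S hp⟩ =
        mulEmon S A (Ideal.Quotient.mk _ (C μ * xmon (p \ b)))) ∧
      (¬ b ⊆ p → φ ⟨xmon p, xmon_mem_SRideal S hp⟩ = 0) := by
  refine forall₂_congr fun p hp => ?_
  rw [charVec_add_degC_nonneg_iff hdisj]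
  refine and_congr_left fun _ => forall_congr' fun hbp => exists_congr fun μ => ?_
  rw [emon_shiftExp hbp, mulEmon_mk, mul_left_comm]

lemma IsHomOfDeg.mem_range_mulEmon {S : Set (Finset (Fin (n+1)))} {A : Fin (n+1) → ℕ}
    {b : Finset (Fin (n+1))} (hdisj : ∀ i ∈ b, A i = 0)
    {φ : SRideal S →ₗ[MvPolynomial (Fin (n+1)) ℂ] (MvPolynomial (Fin (n+1)) ℂ ⧸ SRideal S)}
    (hφ : IsHomOfDeg S φ (degC A b)) (x : SRideal S) : φ x ∈ LinearMap.range (mulEmon S A) := by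
  rw [isHomOfDeg_iff hdisj] at hφ
  obtain ⟨x, hx⟩ := x
  induction hx using Submodule.span_induction with
  | mem q hq =>
    obtain ⟨p, hp, rfl⟩ := hq
    by_cases hbp : b ⊆ p
    · obtain ⟨μ, hμ⟩ := (hφ p hp).1 hbp
      exact ⟨_, hμ.symm⟩
    · rw [(hφ p hp).2 hbp]
      exact zero_mem _
  | zero => exact φ.map_zero ▸ zero_mem _
  | add x y hx hy ihx ihy => exact φ.map_add ⟨x, hx⟩ ⟨y, hy⟩ ▸ add_mem ihx ihy
  | smul r x hx ih => exact φ.map_smul r ⟨x, hx⟩ ▸ Submodule.smul_mem _ r ih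

lemma IsHomOfDeg.rangeTransfer {S : Set (Finset (Fin (n+1)))} {A A' : Fin (n+1) → ℕ}
    {b : Finset (Fin (n+1))} (hdisj : ∀ i ∈ b, A i = 0) (hdisj' : ∀ i ∈ b, A' i = 0)
    (hker : LinearMap.ker (mulEmon S A) = LinearMap.ker (mulEmon S A'))
    {φ : SRideal S →ₗ[MvPolynomial (Fin (n+1)) ℂ] (MvPolynomial (Fin (n+1)) ℂ ⧸ SRideal S)}
    (hφ : IsHomOfDeg S φ (degC A b)) :
    IsHomOfDeg S (rangeTransfer _ _ hker φ (hφ.mem_range_mulEmon hdisj)) (degC A' b) := by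
  have h := (isHomOfDeg_iff hdisj φ).1 hφ
  refine (isHomOfDeg_iff hdisj' _).2 fun p hp => ⟨fun hbp => ?_, fun hbp => ?_⟩
  · obtain ⟨μ, hμ⟩ := (h p hp).1 hbp
    exact ⟨μ, rangeTransfer_apply _ _ hμ⟩
  · rw [rangeTransfer_apply (y := 0) _ _ (by rw [(h p hp).2 hbp, map_zero]), map_zero]

end StanleyReisner

/-- for `𝐚, 𝐚′ ∈ ℕ^{n+1}` with the same support `a`, disjoint from `b`,
the homogeneous pieces `Hom(I_X, A_X)_{𝐚−𝐛}` and `Hom(I_X, A_X)_{𝐚′−𝐛}` are isomorphic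
as ℂ-vector spaces: there is a bijection between them which is additive and
ℂ-homogeneous. -/
theorem hom_piece_depends_only_on_support {n : ℕ} (S : Set (Finset (Fin (n+1))))
    (hS : IsSimplicialComplex S) (A A' : Fin (n+1) → ℕ) (b : Finset (Fin (n+1)))
    (hsupp : ∀ i, A i ≠ 0 ↔ A' i ≠ 0) (hdisj : ∀ i ∈ b, A i = 0) :
    ∃ e : {φ : SRideal S →ₗ[MvPolynomial (Fin (n+1)) ℂ]
            (MvPolynomial (Fin (n+1)) ℂ ⧸ SRideal S) // IsHomOfDeg S φ (degC A b)} ≃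
          {φ : SRideal S →ₗ[MvPolynomial (Fin (n+1)) ℂ]
            (MvPolynomial (Fin (n+1)) ℂ ⧸ SRideal S) // IsHomOfDeg S φ (degC A' b)},
      (∀ φ ψ ω : {φ : SRideal S →ₗ[MvPolynomial (Fin (n+1)) ℂ]
            (MvPolynomial (Fin (n+1)) ℂ ⧸ SRideal S) // IsHomOfDeg S φ (degC A b)},
        ω.1 = φ.1 + ψ.1 → (e ω).1 = (e φ).1 + (e ψ).1) ∧
      (∀ (μ : ℂ) (φ ψ : {φ : SRideal S →ₗ[MvPolynomial (Fin (n+1)) ℂ]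
            (MvPolynomial (Fin (n+1)) ℂ ⧸ SRideal S) // IsHomOfDeg S φ (degC A b)}),
        ψ.1 = (C μ : MvPolynomial (Fin (n+1)) ℂ) • φ.1 →
          (e ψ).1 = (C μ : MvPolynomial (Fin (n+1)) ℂ) • (e φ).1) := by
  have hdisj' : ∀ i ∈ b, A' i = 0 := fun i hi => by
    have := hsupp i
    have := hdisj i hi
    tauto
  have hker := ker_mulEmon_eq S hsupp
  refine ⟨{ toFun := fun φ => ⟨_, φ.2.rangeTransfer hdisj hdisj' hker⟩
            invFun := fun φ => ⟨_, φ.2.rangeTransfer hdisj' hdisj hker.symm⟩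
            left_inv := fun φ => ?_
            right_inv := fun φ => ?_ }, fun φ ψ ω h => ?_, fun μ φ ψ h => ?_⟩
  · refine Subtype.ext (LinearMap.ext fun x => ?_)
    obtain ⟨y, hy⟩ := φ.2.mem_range_mulEmon hdisj x
    exact (rangeTransfer_apply _ _ (rangeTransfer_apply _ _ hy.symm)).trans hy
  · refine Subtype.ext (LinearMap.ext fun x => ?_)
    obtain ⟨y, hy⟩ := φ.2.mem_range_mulEmon hdisj' x
    exact (rangeTransfer_apply _ _ (rangeTransfer_apply _ _ hy.symm)).trans hy
  · refine LinearMap.ext fun x => ?_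
    obtain ⟨y, hy⟩ := φ.2.mem_range_mulEmon hdisj x
    obtain ⟨z, hz⟩ := ψ.2.mem_range_mulEmon hdisj x
    have hω : ω.1 x = mulEmon S A (y + z) := by rw [h, map_add, hy, hz, LinearMap.add_apply]
    simp only [Equiv.coe_fn_mk, LinearMap.add_apply]
    rw [rangeTransfer_apply _ _ hω, rangeTransfer_apply _ _ hy.symm,
      rangeTransfer_apply _ _ hz.symm, map_add]
  · refine LinearMap.ext fun x => ?_
    obtain ⟨y, hy⟩ := φ.2.mem_range_mulEmon hdisj x
    have hψ : ψ.1 x = mulEmon S A ((C μ : MvPolynomial (Fin (n+1)) ℂ) • y) := by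
      rw [h, map_smul, hy, LinearMap.smul_apply]
    simp only [Equiv.coe_fn_mk, LinearMap.smul_apply]
    rw [rangeTransfer_apply _ _ hψ, rangeTransfer_apply _ _ hy.symm, map_smul]
end

section
/- Let X be a simplicial complex on [n] and 𝐜 = 𝐚 − 𝐛 with 𝐚 ∈ ℕ^{n+1} of support a ⊆ [n] and 𝐛 ∈ {0,1}^{n+1} the characteristic vector of b ⊆ [n], where a ∩ b = ∅. For every p ∈ M_{a−b} with b ⊆ p one has 𝐩 + 𝐜 ∈ ℕ^{n+1} and π(x^{𝐩+𝐜}) ≠ 0 in A_X, and the assignment φ ↦ μ_φ — where μ_φ(p) is the unique scalar with φ(x^p) = μ_φ(p)·π(x^{𝐩+𝐜}) for p ∈ M_{a−b} with b ⊆ p, and μ_φ(p) = 0 for p ∈ M_{a−b} with b ⊄ p — is a ℂ-linear isomorphism from Hom(I_X, A_X)_𝐜 onto the space {μ : M_{a−b} → ℂ : μ(p) = 0 whenever b ⊄ p, and μ(p) = μ(q) whenever (p,q) ∈ M^{(2)}_{a−b}}. -/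
open MvPolynomial

section StanleyReisner

variable {n : ℕ}

lemma mem_suppV {e : Fin (n+1) → ℕ} {i : Fin (n+1)} : i ∈ suppV e ↔ e i ≠ 0 := by
  simp [suppV]

@[simp] lemma suppV_charVec (p : Finset (Fin (n+1))) : suppV (charVec p) = p := by
  ext i; simp [mem_suppV, charVec]

lemma charVec_le_iff {p : Finset (Fin (n+1))} {e : Fin (n+1) → ℕ} :
    charVec p ≤ e ↔ p ⊆ suppV e := by
  constructor
  · intro h i hi
    have := h i
    simp only [charVec, hi, if_true] at this
    exact mem_suppV.2 (by omega)
  · intro h i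
    by_cases hi : i ∈ p
    · have := mem_suppV.1 (h hi)
      simp only [charVec, hi, if_true]
      omega
    · simp [charVec, hi]

lemma emon_add (d e : Fin (n+1) → ℕ) : emon (d + e) = emon d * emon e := by
  simp only [emon, monomial_mul, mul_one]
  congr 2
  ext i
  simp

lemma monomial_eq_C_mul_emon (e : Fin (n+1) →₀ ℕ) (r : ℂ) :
    monomial e r = C r * emon (e : Fin (n+1) → ℕ) := by
  simp only [emon, C_mul_monomial, mul_one]
  congr 2
  ext i
  simp

lemma emon_charVec (p : Finset (Fin (n+1))) : emon (charVec p) = xmon p := by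
  rw [emon, monomial_eq, C_1, one_mul, Finsupp.prod_fintype _ _ (by simp), xmon,
    Finset.prod_congr rfl (g := fun i => if i ∈ p then X i else 1)]
  · rw [Finset.prod_ite_mem, Finset.univ_inter]
  · intro i _
    by_cases hi : i ∈ p <;> simp [charVec, hi]

variable {S : Set (Finset (Fin (n+1)))}

/-- A polynomial lies in the Stanley–Reisner ideal iff all its monomials are supported on
nonfaces. -/
lemma mem_SRideal_iff_s5 (hS : IsSimplicialComplex S) {f : MvPolynomial (Fin (n+1)) ℂ} :
    f ∈ SRideal S ↔ ∀ m ∈ f.support, suppV (m : Fin (n+1) → ℕ) ∉ S := by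
  have hspan : SRideal S = Ideal.span ((fun s => monomial s (1 : ℂ)) ''
      {s : Fin (n+1) →₀ ℕ | ∃ p ∉ S, s = Finsupp.equivFunOnFinite.symm (charVec p)}) := by
    rw [SRideal]
    congr 1
    ext q
    constructor
    · rintro ⟨p, hp, rfl⟩
      exact ⟨_, ⟨p, hp, rfl⟩, emon_charVec p⟩
    · rintro ⟨_, ⟨p, hp, rfl⟩, rfl⟩
      exact ⟨p, hp, emon_charVec p⟩
  rw [hspan, mem_ideal_span_monomial_image]
  refine forall₂_congr fun m _ => ⟨?_, fun h => ⟨_, ⟨_, h, rfl⟩, ?_⟩⟩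
  · rintro ⟨_, ⟨p, hp, rfl⟩, hle⟩ hm
    exact hp (hS.2 _ hm _ (charVec_le_iff.1 fun i => hle i))
  · exact fun i => charVec_le_iff.2 (Finset.Subset.refl (suppV (m : Fin (n+1) → ℕ))) i

lemma C_mul_emon_mem_SRideal_iff (hS : IsSimplicialComplex S) {r : ℂ} {e : Fin (n+1) → ℕ} :
    C r * emon e ∈ SRideal S ↔ r = 0 ∨ suppV e ∉ S := by
  classical
  rw [mem_SRideal_iff_s5 hS, emon, C_mul_monomial, mul_one, support_monomial]
  by_cases hr : r = 0 <;> simp [hr]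

lemma mk_emon_eq_zero_iff (hS : IsSimplicialComplex S) {e : Fin (n+1) → ℕ} :
    Ideal.Quotient.mk (SRideal S) (emon e) = 0 ↔ suppV e ∉ S := by
  rw [Ideal.Quotient.eq_zero_iff_mem]
  simpa using C_mul_emon_mem_SRideal_iff hS (r := 1) (e := e)

lemma smul_mk_SRideal (f g : MvPolynomial (Fin (n+1)) ℂ) :
    f • Ideal.Quotient.mk (SRideal S) g = Ideal.Quotient.mk (SRideal S) (f * g) := rfl

lemma mk_C_mul_emon_injective (hS : IsSimplicialComplex S) {e : Fin (n+1) → ℕ}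
    (he : suppV e ∈ S) {r s : ℂ}
    (h : Ideal.Quotient.mk (SRideal S) (C r * emon e) =
      Ideal.Quotient.mk (SRideal S) (C s * emon e)) : r = s := by
  rw [Ideal.Quotient.eq, ← sub_mul, ← C_sub, C_mul_emon_mem_SRideal_iff hS] at h
  exact sub_eq_zero.1 (h.resolve_right (not_not.2 he))

/-- Maps out of the Stanley–Reisner ideal are determined by the nonface monomials. -/
lemma SRideal_hom_ext {N : Type*} [AddCommGroup N] [Module (MvPolynomial (Fin (n+1)) ℂ) N]
    {φ ψ : SRideal S →ₗ[MvPolynomial (Fin (n+1)) ℂ] N}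
    (h : ∀ (p : Finset (Fin (n+1))) (hp : p ∉ S),
      φ ⟨xmon p, xmon_mem_SRideal S hp⟩ = ψ ⟨xmon p, xmon_mem_SRideal S hp⟩) : φ = ψ := by
  ext ⟨f, hf⟩
  refine Submodule.span_induction (p := fun f hf => φ ⟨f, hf⟩ = ψ ⟨f, hf⟩) ?_ ?_ ?_ ?_ hf
  · rintro _ ⟨p, hp, rfl⟩
    exact h p hp
  · exact (map_zero φ).trans (map_zero ψ).symm
  · intro x y hx hy h₁ h₂
    have e : (⟨x + y, add_mem hx hy⟩ : SRideal S) = ⟨x, hx⟩ + ⟨y, hy⟩ := rfl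
    exact (congrArg φ e).trans (((map_add φ _ _).trans (by rw [h₁, h₂, map_add])).trans
      (congrArg ψ e).symm)
  · intro g x hx h₁
    have e : (⟨g • x, Submodule.smul_mem _ g hx⟩ : SRideal S) = g • ⟨x, hx⟩ := rfl
    exact (congrArg φ e).trans (((map_smul φ _ _).trans (by rw [h₁, map_smul])).trans
      (congrArg ψ e).symm)

variable {A : Fin (n+1) → ℕ} {b : Finset (Fin (n+1))}

lemma shift_nonneg_iff (hdisj : ∀ i ∈ b, A i = 0) {p : Finset (Fin (n+1))} :
    (∀ i, 0 ≤ (charVec p i : ℤ) + degC A b i) ↔ b ⊆ p := by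
  refine forall_congr' fun i => ?_
  have := hdisj i
  by_cases hb : i ∈ b <;> by_cases hp : i ∈ p <;> simp_all [charVec, degC]
  omega

lemma shiftExp_degC (p : Finset (Fin (n+1))) :
    shiftExp p (degC A b) = charVec p + A - charVec b := by
  ext i
  simp only [shiftExp, degC, Pi.add_apply, Pi.sub_apply]
  omega

lemma sdiff_subset_suppV_add_sub (e : Fin (n+1) → ℕ) :
    (suppV e ∪ suppV A) \ b ⊆ suppV (e + A - charVec b) := by
  intro i
  simp only [Finset.mem_sdiff, Finset.mem_union, mem_suppV, Pi.sub_apply, Pi.add_apply, charVec]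
  rintro ⟨h, hb⟩
  rw [if_neg hb]
  omega

lemma suppV_charVec_add_sub (hdisj : ∀ i ∈ b, A i = 0) (p : Finset (Fin (n+1))) :
    suppV (charVec p + A - charVec b) = (p ∪ suppV A) \ b := by
  ext i
  have := hdisj i
  by_cases hb : i ∈ b <;> by_cases hp : i ∈ p <;>
    simp_all [mem_suppV, charVec]

lemma add_add_sub_charVec (d : Fin (n+1) → ℕ) {e : Fin (n+1) → ℕ} (h : b ⊆ suppV e) :
    d + e + A - charVec b = d + (e + A - charVec b) := by
  ext i
  have : charVec b i ≤ e i := charVec_le_iff.2 h i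
  simp only [Pi.add_apply, Pi.sub_apply]
  omega

lemma suppV_add (d e : Fin (n+1) → ℕ) : suppV (d + e) = suppV d ∪ suppV e := by
  ext i
  simp only [mem_suppV, Finset.mem_union, Pi.add_apply]
  omega

variable (S A b) in
/-- The `ℂ`-linear map `P → A_X` sending `x^e` to `w (supp e) · π(x^{e+A-b})`
(with truncated subtraction). -/
noncomputable def weightedShift (w : Finset (Fin (n+1)) → ℂ) :
    MvPolynomial (Fin (n+1)) ℂ →ₗ[ℂ] MvPolynomial (Fin (n+1)) ℂ ⧸ SRideal S :=
  (basisMonomials (Fin (n+1)) ℂ).constr ℂ fun e =>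
    Ideal.Quotient.mk (SRideal S)
      (C (w (suppV (e : Fin (n+1) → ℕ))) * emon ((e : Fin (n+1) → ℕ) + A - charVec b))

lemma weightedShift_emon (w : Finset (Fin (n+1)) → ℂ) (e : Fin (n+1) → ℕ) :
    weightedShift S A b w (emon e) =
      Ideal.Quotient.mk (SRideal S) (C (w (suppV e)) * emon (e + A - charVec b)) := by
  have := (basisMonomials (Fin (n+1)) ℂ).constr_basis ℂ (fun e =>
    Ideal.Quotient.mk (SRideal S)
      (C (w (suppV (e : Fin (n+1) → ℕ))) * emon ((e : Fin (n+1) → ℕ) + A - charVec b)))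
    (Finsupp.equivFunOnFinite.symm e)
  rw [coe_basisMonomials] at this
  exact this

lemma weightedShift_emon_mul_emon (hS : IsSimplicialComplex S) {w : Finset (Fin (n+1)) → ℂ}
    (hw : ∀ p, ¬ b ⊆ p → w p = 0)
    (hw' : ∀ p ∉ S, ∀ q, p ⊆ q → (q ∪ suppV A) \ b ∈ S → w p = w q)
    (d : Fin (n+1) → ℕ) {e : Fin (n+1) → ℕ} (he : suppV e ∉ S) :
    weightedShift S A b w (emon d * emon e) = emon d • weightedShift S A b w (emon e) := by
  rw [← emon_add, weightedShift_emon, weightedShift_emon, smul_mk_SRideal,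
    mul_left_comm, ← emon_add]
  by_cases hm : suppV (d + e + A - charVec b) ∈ S
  · have hq := hS.2 _ hm _ (sdiff_subset_suppV_add_sub (d + e))
    rw [← hw' _ he _ (by rw [suppV_add]; exact Finset.subset_union_right) hq]
    by_cases hb : b ⊆ suppV e
    · rw [add_add_sub_charVec d hb]
    · simp [hw _ hb]
  · rw [Ideal.Quotient.eq_zero_iff_mem.2 ((C_mul_emon_mem_SRideal_iff hS).2 (Or.inr hm)), eq_comm,
      Ideal.Quotient.eq_zero_iff_mem, C_mul_emon_mem_SRideal_iff hS]
    by_cases hb : b ⊆ suppV e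
    · exact Or.inr (add_add_sub_charVec d hb ▸ hm)
    · exact Or.inl (hw _ hb)

lemma weightedShift_mul (hS : IsSimplicialComplex S) {w : Finset (Fin (n+1)) → ℂ}
    (hw : ∀ p, ¬ b ⊆ p → w p = 0)
    (hw' : ∀ p ∉ S, ∀ q, p ⊆ q → (q ∪ suppV A) \ b ∈ S → w p = w q)
    (g : MvPolynomial (Fin (n+1)) ℂ) {f : MvPolynomial (Fin (n+1)) ℂ} (hf : f ∈ SRideal S) :
    weightedShift S A b w (g * f) = g • weightedShift S A b w f := by
  induction g using MvPolynomial.induction_on' with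
  | add p q hp hq => rw [add_mul, map_add, hp, hq, add_smul]
  | monomial u a =>
    rw [f.as_sum, Finset.mul_sum, map_sum, map_sum, Finset.smul_sum]
    refine Finset.sum_congr rfl fun v hv => ?_
    rw [monomial_eq_C_mul_emon, monomial_eq_C_mul_emon, ← smul_eq_C_mul, ← smul_eq_C_mul,
      smul_mul_smul_comm, map_smul, map_smul,
      weightedShift_emon_mul_emon hS hw hw' _ ((mem_SRideal_iff_s5 hS).1 hf v hv), smul_assoc,
      smul_comm (emon _) (coeff v f), smul_smul]

/-- The restriction of `weightedShift` to the Stanley–Reisner ideal as a module homomorphism. -/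
noncomputable def weightedShiftHom (hS : IsSimplicialComplex S) {w : Finset (Fin (n+1)) → ℂ}
    (hw : ∀ p, ¬ b ⊆ p → w p = 0)
    (hw' : ∀ p ∉ S, ∀ q, p ⊆ q → (q ∪ suppV A) \ b ∈ S → w p = w q) :
    SRideal S →ₗ[MvPolynomial (Fin (n+1)) ℂ] MvPolynomial (Fin (n+1)) ℂ ⧸ SRideal S where
  toFun f := weightedShift S A b w f
  map_add' f g := map_add (weightedShift S A b w) (f : MvPolynomial (Fin (n+1)) ℂ) g
  map_smul' g f := weightedShift_mul hS hw hw' g f.2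

lemma weightedShiftHom_xmon (hS : IsSimplicialComplex S) {w : Finset (Fin (n+1)) → ℂ}
    (hw : ∀ p, ¬ b ⊆ p → w p = 0)
    (hw' : ∀ p ∉ S, ∀ q, p ⊆ q → (q ∪ suppV A) \ b ∈ S → w p = w q)
    {p : Finset (Fin (n+1))} (hp : p ∉ S) :
    weightedShiftHom hS hw hw' ⟨xmon p, xmon_mem_SRideal S hp⟩ =
      Ideal.Quotient.mk (SRideal S) (C (w p) * emon (shiftExp p (degC A b))) := by
  change weightedShift S A b w (xmon p) = _
  rw [← emon_charVec, weightedShift_emon, suppV_charVec, shiftExp_degC]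

lemma xmon_sdiff_smul_comm {N : Type*} [AddCommGroup N] [Module (MvPolynomial (Fin (n+1)) ℂ) N]
    (φ : SRideal S →ₗ[MvPolynomial (Fin (n+1)) ℂ] N) {p q : Finset (Fin (n+1))}
    (hp : p ∉ S) (hq : q ∉ S) :
    xmon (q \ p) • φ ⟨xmon p, xmon_mem_SRideal S hp⟩ =
      xmon (p \ q) • φ ⟨xmon q, xmon_mem_SRideal S hq⟩ := by
  rw [← map_smul, ← map_smul]
  congr 1
  apply Subtype.ext
  change xmon (q \ p) * xmon p = xmon (p \ q) * xmon q
  rw [xmon, xmon, xmon, xmon, ← Finset.prod_union Finset.sdiff_disjoint,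
    ← Finset.prod_union Finset.sdiff_disjoint, Finset.sdiff_union_self_eq_union,
    Finset.sdiff_union_self_eq_union, Finset.union_comm]

lemma suppV_shiftExp (hdisj : ∀ i ∈ b, A i = 0) (p : Finset (Fin (n+1))) :
    suppV (shiftExp p (degC A b)) = (p ∪ suppV A) \ b := by
  rw [shiftExp_degC, suppV_charVec_add_sub hdisj]

/-- The scalars of a homomorphism of degree `𝐜` agree on pairs of nonfaces `p`, `q` with
`(p ∪ q ∪ a) ∖ b ∈ X`. -/
lemma weight_eq_of_isHomOfDeg (hS : IsSimplicialComplex S) (hdisj : ∀ i ∈ b, A i = 0)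
    {φ : SRideal S →ₗ[MvPolynomial (Fin (n+1)) ℂ] MvPolynomial (Fin (n+1)) ℂ ⧸ SRideal S}
    {p q : Finset (Fin (n+1))} (hp : p ∉ S) (hq : q ∉ S) (hbp : b ⊆ p) {r s : ℂ}
    (hr : φ ⟨xmon p, xmon_mem_SRideal S hp⟩ =
      Ideal.Quotient.mk (SRideal S) (C r * emon (shiftExp p (degC A b))))
    (hs : φ ⟨xmon q, xmon_mem_SRideal S hq⟩ =
      Ideal.Quotient.mk (SRideal S) (C s * emon (shiftExp q (degC A b))))
    (hs' : ¬ b ⊆ q → s = 0)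
    (hpq : (p ∪ q ∪ suppV A) \ b ∈ S) : r = s := by
  have key := xmon_sdiff_smul_comm φ hp hq
  rw [hr, hs, smul_mk_SRideal, smul_mk_SRideal, mul_left_comm, mul_left_comm (xmon (p \ q)),
    ← emon_charVec, ← emon_charVec, ← emon_add, ← emon_add] at key
  have hsupp : suppV (charVec (q \ p) + shiftExp p (degC A b)) = (p ∪ q ∪ suppV A) \ b := by
    rw [suppV_add, suppV_charVec, suppV_shiftExp hdisj]
    ext i
    have := @hbp i
    simp only [Finset.mem_union, Finset.mem_sdiff]
    tauto
  refine mk_C_mul_emon_injective hS (hsupp ▸ hpq) (key.trans ?_)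
  by_cases hbq : b ⊆ q
  · have hexp : charVec (q \ p) + shiftExp p (degC A b) =
        charVec (p \ q) + shiftExp q (degC A b) := by
      rw [shiftExp_degC, shiftExp_degC, ← add_add_sub_charVec _ (by rwa [suppV_charVec]),
        ← add_add_sub_charVec _ (by rwa [suppV_charVec])]
      congr 2
      ext i
      by_cases hip : i ∈ p <;> by_cases hiq : i ∈ q <;> simp [charVec, hip, hiq]
    rw [hexp]
  · simp [hs' hbq]

end StanleyReisner

/-- for `𝐜 = 𝐚 − 𝐛` (`𝐛` the characteristic vector of `b`, support of `𝐚`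
disjoint from `b`):  for every `p ∈ M_{a−b}` with `b ⊆ p` one has `𝐩 + 𝐜 ∈ ℕ^{n+1}` and
`π(x^{𝐩+𝐜}) ≠ 0`; and `φ ↦ μ_φ` is a ℂ-linear isomorphism from `Hom(I_X,A_X)_𝐜` onto
`{μ : M_{a−b} → ℂ : μ(p) = 0 if b ⊄ p, μ(p) = μ(q) if (p,q) ∈ M^{(2)}_{a−b}}`. -/
theorem hom_piece_iso_M_functions {n : ℕ} (S : Set (Finset (Fin (n+1))))
    (hS : IsSimplicialComplex S) (A : Fin (n+1) → ℕ) (b : Finset (Fin (n+1)))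
    (hdisj : ∀ i ∈ b, A i = 0) :
    (∀ p ∈ Mab S (suppV A) b, b ⊆ p →
      (∀ i, 0 ≤ (charVec p i : ℤ) + degC A b i) ∧
      Ideal.Quotient.mk (SRideal S) (emon (shiftExp p (degC A b))) ≠ 0) ∧
    ∃ E : {φ : SRideal S →ₗ[MvPolynomial (Fin (n+1)) ℂ]
            (MvPolynomial (Fin (n+1)) ℂ ⧸ SRideal S) // IsHomOfDeg S φ (degC A b)} ≃
          {μ : {p : Finset (Fin (n+1)) // p ∈ Mab S (suppV A) b} → ℂ //
            (∀ p, ¬ b ⊆ p.1 → μ p = 0) ∧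
            ∀ p q, (p.1 ∪ q.1 ∪ suppV A) \ b ∈ S → μ p = μ q},
      (∀ (φ : {φ : SRideal S →ₗ[MvPolynomial (Fin (n+1)) ℂ]
            (MvPolynomial (Fin (n+1)) ℂ ⧸ SRideal S) // IsHomOfDeg S φ (degC A b)})
         (p : {p : Finset (Fin (n+1)) // p ∈ Mab S (suppV A) b}), b ⊆ p.1 →
        φ.1 ⟨xmon p.1, xmon_mem_SRideal S p.2.1⟩ =
          Ideal.Quotient.mk (SRideal S)
            (C ((E φ).1 p) * emon (shiftExp p.1 (degC A b)))) ∧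
      (∀ φ ψ ω, ω.1 = φ.1 + ψ.1 → ∀ p, (E ω).1 p = (E φ).1 p + (E ψ).1 p) ∧
      (∀ (μ₀ : ℂ) φ ψ, ψ.1 = (C μ₀ : MvPolynomial (Fin (n+1)) ℂ) • φ.1 →
        ∀ p, (E ψ).1 p = μ₀ * (E φ).1 p) := by
  classical
  refine ⟨fun p hp hb => ⟨(shift_nonneg_iff hdisj).2 hb, fun h =>
    (mk_emon_eq_zero_iff hS).1 h (by rw [suppV_shiftExp hdisj]; exact hp.2)⟩, ?_⟩
  have inj : ∀ p ∈ Mab S (suppV A) b, ∀ r s : ℂ,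
      Ideal.Quotient.mk (SRideal S) (C r * emon (shiftExp p (degC A b))) =
        Ideal.Quotient.mk (SRideal S) (C s * emon (shiftExp p (degC A b))) → r = s :=
    fun p hp r s => mk_C_mul_emon_injective hS (by rw [suppV_shiftExp hdisj]; exact hp.2)
  have weights : ∀ φ : {φ : SRideal S →ₗ[MvPolynomial (Fin (n+1)) ℂ]
      (MvPolynomial (Fin (n+1)) ℂ ⧸ SRideal S) // IsHomOfDeg S φ (degC A b)},
      ∀ p : {p : Finset (Fin (n+1)) // p ∈ Mab S (suppV A) b}, ∃ r : ℂ, (¬ b ⊆ p.1 → r = 0) ∧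
        φ.1 ⟨xmon p.1, xmon_mem_SRideal S p.2.1⟩ =
          Ideal.Quotient.mk (SRideal S) (C r * emon (shiftExp p.1 (degC A b))) := by
    intro φ p
    by_cases hb : b ⊆ p.1
    · obtain ⟨r, hr⟩ := (φ.2 p.1 p.2.1).1 ((shift_nonneg_iff hdisj).2 hb)
      exact ⟨r, fun h => absurd hb h, hr⟩
    · refine ⟨0, fun _ => rfl, ?_⟩
      rw [(φ.2 p.1 p.2.1).2 (mt (shift_nonneg_iff hdisj).1 hb)]
      simp
  choose W hW₀ hW using weights
  have hW_eq : ∀ φ p q, (p.1 ∪ q.1 ∪ suppV A) \ b ∈ S → W φ p = W φ q := by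
    intro φ p q hpq
    by_cases hbp : b ⊆ p.1
    · exact weight_eq_of_isHomOfDeg hS hdisj p.2.1 q.2.1 hbp (hW φ p) (hW φ q) (hW₀ φ q) hpq
    by_cases hbq : b ⊆ q.1
    · rw [Finset.union_comm p.1] at hpq
      exact (weight_eq_of_isHomOfDeg hS hdisj q.2.1 p.2.1 hbq (hW φ q) (hW φ p)
        (hW₀ φ p) hpq).symm
    · rw [hW₀ φ p hbp, hW₀ φ q hbq]
  have bij : Function.Bijective (fun φ => (⟨W φ, hW₀ φ, hW_eq φ⟩ :
      {μ : {p : Finset (Fin (n+1)) // p ∈ Mab S (suppV A) b} → ℂ //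
        (∀ p, ¬ b ⊆ p.1 → μ p = 0) ∧
        ∀ p q, (p.1 ∪ q.1 ∪ suppV A) \ b ∈ S → μ p = μ q})) := by
    constructor
    · intro φ ψ h
      have hWW : W φ = W ψ := congrArg Subtype.val h
      refine Subtype.ext (SRideal_hom_ext fun p hp => ?_)
      by_cases hb : b ⊆ p
      · by_cases hpM : (p ∪ suppV A) \ b ∈ S
        · have h₁ := hW φ ⟨p, hp, hpM⟩
          rw [hWW] at h₁
          exact h₁.trans (hW ψ ⟨p, hp, hpM⟩).symm
        · have hz : ∀ r : ℂ, Ideal.Quotient.mk (SRideal S)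
              (C r * emon (shiftExp p (degC A b))) = 0 := fun r =>
            Ideal.Quotient.eq_zero_iff_mem.2 ((C_mul_emon_mem_SRideal_iff hS).2
              (Or.inr (by rwa [suppV_shiftExp hdisj])))
          obtain ⟨r, hr⟩ := (φ.2 p hp).1 ((shift_nonneg_iff hdisj).2 hb)
          obtain ⟨s, hs⟩ := (ψ.2 p hp).1 ((shift_nonneg_iff hdisj).2 hb)
          rw [hr, hs, hz, hz]
      · have hb' := mt (shift_nonneg_iff hdisj (A := A)).1 hb
        rw [(φ.2 p hp).2 hb', (ψ.2 p hp).2 hb']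
    · rintro ⟨μ, hμ₀, hμ⟩
      set w : Finset (Fin (n+1)) → ℂ :=
        fun p => if h : p ∈ Mab S (suppV A) b then μ ⟨p, h⟩ else 0 with hwdef
      have hw : ∀ p, ¬ b ⊆ p → w p = 0 := by
        intro p hp
        by_cases h : p ∈ Mab S (suppV A) b
        · simpa only [hwdef, dif_pos h] using hμ₀ ⟨p, h⟩ hp
        · simp only [hwdef, dif_neg h]
      have hw' : ∀ p ∉ S, ∀ q, p ⊆ q → (q ∪ suppV A) \ b ∈ S → w p = w q := by
        intro p hp q hpq hq
        have hpM : p ∈ Mab S (suppV A) b := ⟨hp, hS.2 _ hq _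
          (Finset.sdiff_subset_sdiff (Finset.union_subset_union_left hpq) subset_rfl)⟩
        have hqM : q ∈ Mab S (suppV A) b := ⟨fun h => hp (hS.2 _ h _ hpq), hq⟩
        simp only [hwdef, dif_pos hpM, dif_pos hqM]
        exact hμ _ _ (by rwa [Finset.union_eq_right.2 hpq])
      refine ⟨⟨weightedShiftHom hS hw hw', fun p hp => ⟨fun _ =>
        ⟨w p, weightedShiftHom_xmon hS hw hw' hp⟩, fun h => ?_⟩⟩, ?_⟩
      · rw [weightedShiftHom_xmon hS hw hw' hp, hw p (mt (shift_nonneg_iff hdisj).2 h)]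
        simp
      · refine Subtype.ext (funext fun p => ?_)
        refine (inj p.1 p.2 _ (w p.1) ((hW _ p).symm.trans
          (weightedShiftHom_xmon hS hw hw' p.2.1))).trans ?_
        simp only [hwdef, dif_pos p.2]
  refine ⟨Equiv.ofBijective _ bij, fun φ p _ => hW φ p, fun φ ψ ω h p => ?_,
    fun μ₀ φ ψ h p => ?_⟩
  · refine inj p.1 p.2 _ _ ((hW ω p).symm.trans ?_)
    rw [h, LinearMap.add_apply, hW, hW, ← map_add, ← add_mul, ← C_add]
    rfl
  · refine inj p.1 p.2 _ _ ((hW ψ p).symm.trans ?_)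
    rw [h, LinearMap.smul_apply, hW, smul_mk_SRideal, ← mul_assoc, ← C_mul]
    rfl
end

section
/- Let X be a simplicial complex on [n] and a, b ⊆ [n] disjoint with b ≠ ∅. Let V_M be the quotient of the ℂ-vector space of antisymmetric functions μ : M^{(2)}_{a−b} → ℂ satisfying (α) μ(p,q) = 0 whenever (p ∩ q) ∪ ((p ∪ q ∪ a) ∖ b) ∈ X or b ⊄ p ∪ q, and (β) μ(p,q) − μ(p,r) + μ(q,r) = 0 whenever p, q, r ∈ M_{a−b} with (p ∪ q ∪ r ∪ a) ∖ b ∈ X, by the subspace of functions of the form μ(p,q) = μ′(p) − μ′(q) for some μ′ : M_{a−b} → ℂ with μ′(m) = 0 whenever b ⊄ m. Let V_N be the quotient of the ℂ-vector space of antisymmetric functions λ : N^{(2)}_{a−b} → ℂ satisfying λ(f,g) = 0 whenever f, g ∈ Ñ_{a−b}, and λ(f,g) − λ(f,h) + λ(g,h) = 0 whenever f, g, h ∈ N_{a−b} with f ∪ g ∪ h ∈ X, by the subspace of functions of the form λ(f,g) = λ′(f) − λ′(g) for some λ′ : N_{a−b} → ℂ vanishing on Ñ_{a−b}. Then pullback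 along Φ, sending λ to the function μ(p,q) := λ(Φ(p), Φ(q)), induces a well-defined ℂ-linear isomorphism V_N → V_M. -/
/-- The space of antisymmetric functions `μ : M^{(2)}_{a−b} → ℂ` satisfying the
Koszul vanishing condition (α) and the cocycle condition (β). -/
noncomputable def ZM {n : ℕ} (S : Set (Finset (Fin (n+1)))) (a b : Finset (Fin (n+1))) :
    Submodule ℂ ({pq : Finset (Fin (n+1)) × Finset (Fin (n+1)) // pq ∈ M2 S a b} → ℂ) where
  carrier := {μ |
    (∀ p q (h : (p, q) ∈ M2 S a b) (h' : (q, p) ∈ M2 S a b),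
      μ ⟨(p, q), h⟩ = - μ ⟨(q, p), h'⟩) ∧
    (∀ p q (h : (p, q) ∈ M2 S a b),
      ((p ∩ q) ∪ ((p ∪ q ∪ a) \ b) ∈ S ∨ ¬ b ⊆ p ∪ q) → μ ⟨(p, q), h⟩ = 0) ∧
    (∀ p q r (hpq : (p, q) ∈ M2 S a b) (hpr : (p, r) ∈ M2 S a b)
      (hqr : (q, r) ∈ M2 S a b), (p ∪ q ∪ r ∪ a) \ b ∈ S →
      μ ⟨(p, q), hpq⟩ - μ ⟨(p, r), hpr⟩ + μ ⟨(q, r), hqr⟩ = 0)}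
  add_mem' := by
    rintro μ ν ⟨h1, h2, h3⟩ ⟨g1, g2, g3⟩
    refine ⟨fun p q h h' => ?_, fun p q h hc => ?_, fun p q r hpq hpr hqr hu => ?_⟩
    · simp only [Pi.add_apply, h1 p q h h', g1 p q h h']; ring
    · simp only [Pi.add_apply, h2 p q h hc, g2 p q h hc]; ring
    · simp only [Pi.add_apply]
      linear_combination h3 p q r hpq hpr hqr hu + g3 p q r hpq hpr hqr hu
  zero_mem' := by
    refine ⟨fun p q h h' => ?_, fun p q h hc => ?_, fun p q r hpq hpr hqr hu => ?_⟩ <;> simp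
  smul_mem' := by
    rintro c μ ⟨h1, h2, h3⟩
    refine ⟨fun p q h h' => ?_, fun p q h hc => ?_, fun p q r hpq hpr hqr hu => ?_⟩
    · simp only [Pi.smul_apply, smul_eq_mul, h1 p q h h']; ring
    · simp only [Pi.smul_apply, smul_eq_mul, h2 p q h hc]; ring
    · simp only [Pi.smul_apply, smul_eq_mul]
      linear_combination c * h3 p q r hpq hpr hqr hu

/-- The coboundary subspace of `ZM`: functions of the form `μ(p,q) = μ′(p) − μ′(q)`
with `μ′(m) = 0` whenever `b ⊄ m`. -/
noncomputable def BM {n : ℕ} (S : Set (Finset (Fin (n+1)))) (a b : Finset (Fin (n+1))) :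
    Submodule ℂ (ZM S a b) where
  carrier := {μ | ∃ μ' : Finset (Fin (n+1)) → ℂ,
    (∀ m, ¬ b ⊆ m → μ' m = 0) ∧
    ∀ x : {pq : Finset (Fin (n+1)) × Finset (Fin (n+1)) // pq ∈ M2 S a b},
      μ.1 x = μ' x.1.1 - μ' x.1.2}
  add_mem' := by
    rintro μ ν ⟨m1, hm1, hm1'⟩ ⟨m2, hm2, hm2'⟩
    refine ⟨m1 + m2, fun m hm => by simp [hm1 m hm, hm2 m hm], fun x => ?_⟩
    have e1 := hm1' x; have e2 := hm2' x
    simp only [Submodule.coe_add, Pi.add_apply] at *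
    rw [e1, e2]; ring
  zero_mem' := ⟨0, by simp, by simp⟩
  smul_mem' := by
    rintro c μ ⟨m1, hm1, hm1'⟩
    refine ⟨c • m1, fun m hm => by simp [hm1 m hm], fun x => ?_⟩
    have e1 := hm1' x
    simp only [SetLike.val_smul, Pi.smul_apply, smul_eq_mul] at *
    rw [e1]; ring

/-- The space of antisymmetric functions `λ : N^{(2)}_{a−b} → ℂ` vanishing on pairs
from `Ñ_{a−b}` and satisfying the cocycle condition. -/
noncomputable def ZN {n : ℕ} (S : Set (Finset (Fin (n+1)))) (a b : Finset (Fin (n+1))) :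
    Submodule ℂ ({fg : Finset (Fin (n+1)) × Finset (Fin (n+1)) // fg ∈ N2 S a b} → ℂ) where
  carrier := {lam |
    (∀ f g (h : (f, g) ∈ N2 S a b) (h' : (g, f) ∈ N2 S a b),
      lam ⟨(f, g), h⟩ = - lam ⟨(g, f), h'⟩) ∧
    (∀ f g (h : (f, g) ∈ N2 S a b),
      f ∈ Ntilde S a b → g ∈ Ntilde S a b → lam ⟨(f, g), h⟩ = 0) ∧
    (∀ f g h (hfg : (f, g) ∈ N2 S a b) (hfh : (f, h) ∈ N2 S a b)
      (hgh : (g, h) ∈ N2 S a b), f ∪ g ∪ h ∈ S →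
      lam ⟨(f, g), hfg⟩ - lam ⟨(f, h), hfh⟩ + lam ⟨(g, h), hgh⟩ = 0)}
  add_mem' := by
    rintro μ ν ⟨h1, h2, h3⟩ ⟨g1, g2, g3⟩
    refine ⟨fun f g h h' => ?_, fun f g h hf hg => ?_, fun f g h hfg hfh hgh hu => ?_⟩
    · simp only [Pi.add_apply, h1 f g h h', g1 f g h h']; ring
    · simp only [Pi.add_apply, h2 f g h hf hg, g2 f g h hf hg]; ring
    · simp only [Pi.add_apply]
      linear_combination h3 f g h hfg hfh hgh hu + g3 f g h hfg hfh hgh hu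
  zero_mem' := by
    refine ⟨fun f g h h' => ?_, fun f g h hf hg => ?_, fun f g h hfg hfh hgh hu => ?_⟩ <;> simp
  smul_mem' := by
    rintro c μ ⟨h1, h2, h3⟩
    refine ⟨fun f g h h' => ?_, fun f g h hf hg => ?_, fun f g h hfg hfh hgh hu => ?_⟩
    · simp only [Pi.smul_apply, smul_eq_mul, h1 f g h h']; ring
    · simp only [Pi.smul_apply, smul_eq_mul, h2 f g h hf hg]; ring
    · simp only [Pi.smul_apply, smul_eq_mul]
      linear_combination c * h3 f g h hfg hfh hgh hu

/-- The coboundary subspace of `ZN`: functions of the form `λ(f,g) = λ′(f) − λ′(g)`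
with `λ′` vanishing on `Ñ_{a−b}`. -/
noncomputable def BN {n : ℕ} (S : Set (Finset (Fin (n+1)))) (a b : Finset (Fin (n+1))) :
    Submodule ℂ (ZN S a b) where
  carrier := {lam | ∃ lam' : Finset (Fin (n+1)) → ℂ,
    (∀ f, f ∈ Ntilde S a b → lam' f = 0) ∧
    ∀ x : {fg : Finset (Fin (n+1)) × Finset (Fin (n+1)) // fg ∈ N2 S a b},
      lam.1 x = lam' x.1.1 - lam' x.1.2}
  add_mem' := by
    rintro μ ν ⟨m1, hm1, hm1'⟩ ⟨m2, hm2, hm2'⟩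
    refine ⟨m1 + m2, fun f hf => by simp [hm1 f hf, hm2 f hf], fun x => ?_⟩
    have e1 := hm1' x; have e2 := hm2' x
    simp only [Submodule.coe_add, Pi.add_apply] at *
    rw [e1, e2]; ring
  zero_mem' := ⟨0, by simp, by simp⟩
  smul_mem' := by
    rintro c μ ⟨m1, hm1, hm1'⟩
    refine ⟨c • m1, fun f hf => by simp [hm1 f hf], fun x => ?_⟩
    have e1 := hm1' x
    simp only [SetLike.val_smul, Pi.smul_apply, smul_eq_mul] at *
    rw [e1]; ring

section Pullback

variable {n : ℕ} {S : Set (Finset (Fin (n+1)))} {a b : Finset (Fin (n+1))}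

lemma IsSimplicialComplex.mem_of_subset (hS : IsSimplicialComplex S) {f g : Finset (Fin (n+1))}
    (hf : f ∈ S) (hg : g ⊆ f) : g ∈ S :=
  hS.2 f hf g hg

lemma union_union_sdiff (p q a b : Finset (Fin (n+1))) :
    (p ∪ q ∪ a) \ b = ((p ∪ a) \ b) ∪ ((q ∪ a) \ b) := by
  grind

lemma mem_Nab_of_mem_Mab (hS : IsSimplicialComplex S) (hab : Disjoint a b)
    {p : Finset (Fin (n+1))} (hp : p ∈ Mab S a b) : (p ∪ a) \ b ∈ Nab S a b := by
  rw [Finset.disjoint_left] at hab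
  refine ⟨hp.2, by grind, by grind, fun h => hp.1 (hS.mem_of_subset h (by grind))⟩

lemma mem_Ntilde_of_mem_Mab (hS : IsSimplicialComplex S) (hab : Disjoint a b)
    {p : Finset (Fin (n+1))} (hp : p ∈ Mab S a b) (hbp : ¬ b ⊆ p) :
    (p ∪ a) \ b ∈ Ntilde S a b :=
  ⟨mem_Nab_of_mem_Mab hS hab hp, p ∩ b,
    ⟨Finset.inter_subset_right, fun h => hbp (h.trans Finset.inter_subset_left)⟩,
    fun h => hp.1 (hS.mem_of_subset h (by grind))⟩

lemma pair_mem_N2_of_mem_M2 (hS : IsSimplicialComplex S) (hab : Disjoint a b)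
    {p q : Finset (Fin (n+1))} (h : (p, q) ∈ M2 S a b) :
    ((p ∪ a) \ b, (q ∪ a) \ b) ∈ N2 S a b :=
  ⟨mem_Nab_of_mem_Mab hS hab h.1, mem_Nab_of_mem_Mab hS hab h.2.1,
    hS.mem_of_subset h.2.2 (by grind)⟩

lemma union_sdiff_eq_of_mem_Nab {f c : Finset (Fin (n+1))} (hf : f ∈ Nab S a b) (hc : c ⊆ b) :
    ((f ∪ c) ∪ a) \ b = f := by
  obtain ⟨-, haf, hfb, -⟩ := hf
  rw [← Finset.disjoint_iff_inter_eq_empty, Finset.disjoint_left] at hfb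
  grind

lemma union_mem_Mab {f c : Finset (Fin (n+1))} (hf : f ∈ Nab S a b) (hc : c ⊆ b)
    (hfc : f ∪ c ∉ S) : f ∪ c ∈ Mab S a b :=
  ⟨hfc, by rw [union_sdiff_eq_of_mem_Nab hf hc]; exact hf.1⟩

/-- Every element of `N_{a−b}` lifts along `Φ`, and the elements of `Ñ_{a−b}` lift to sets not
containing `b`. -/
lemma exists_lift (S : Set (Finset (Fin (n+1)))) (a b : Finset (Fin (n+1))) :
    ∃ r : Finset (Fin (n+1)) → Finset (Fin (n+1)), ∀ f ∈ Nab S a b,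
      r f ∈ Mab S a b ∧ (r f ∪ a) \ b = f ∧ (f ∈ Ntilde S a b → ¬ b ⊆ r f) := by
  have key : ∀ f, ∃ p, f ∈ Nab S a b →
      p ∈ Mab S a b ∧ (p ∪ a) \ b = f ∧ (f ∈ Ntilde S a b → ¬ b ⊆ p) := by
    intro f
    by_cases hf : f ∈ Ntilde S a b
    · obtain ⟨hN, c, hc, hfc⟩ := hf
      refine ⟨f ∪ c, fun _ => ⟨union_mem_Mab hN hc.1 hfc,
        union_sdiff_eq_of_mem_Nab hN hc.1, fun _ h => hc.2 fun x hx => ?_⟩⟩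
      have hfb := hN.2.2.1
      rw [← Finset.disjoint_iff_inter_eq_empty, Finset.disjoint_left] at hfb
      grind
    · exact ⟨f ∪ b, fun hN => ⟨union_mem_Mab hN subset_rfl hN.2.2.2,
        union_sdiff_eq_of_mem_Nab hN subset_rfl, fun h => absurd h hf⟩⟩
  choose r hr using key
  exact ⟨r, hr⟩

lemma ZN.apply_self {lam : {fg : Finset (Fin (n+1)) × Finset (Fin (n+1)) // fg ∈ N2 S a b} → ℂ}
    (hlam : lam ∈ ZN S a b) {f : Finset (Fin (n+1))} (h : (f, f) ∈ N2 S a b) :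
    lam ⟨(f, f), h⟩ = 0 :=
  self_eq_neg.mp (hlam.1 f f h h)

/-- A cocycle in `ZM` vanishes on all pairs of sets neither of which contains `b`. -/
lemma ZM.apply_eq_zero (hS : IsSimplicialComplex S)
    {μ : {pq : Finset (Fin (n+1)) × Finset (Fin (n+1)) // pq ∈ M2 S a b} → ℂ}
    (hμ : μ ∈ ZM S a b) {p q : Finset (Fin (n+1))} (h : (p, q) ∈ M2 S a b)
    (hp : ¬ b ⊆ p) (hq : ¬ b ⊆ q) : μ ⟨(p, q), h⟩ = 0 := by
  obtain ⟨-, hα, hβ⟩ := hμ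
  by_cases hs : (p ∩ q) ∪ ((p ∪ q ∪ a) \ b) ∈ S
  · exact hα p q h (Or.inl hs)
  set s := (p ∩ q) ∪ ((p ∪ q ∪ a) \ b) with hsdef
  have hsM : s ∈ Mab S a b := ⟨hs, hS.mem_of_subset h.2.2 (by grind)⟩
  have hps : (p, s) ∈ M2 S a b := ⟨h.1, hsM, hS.mem_of_subset h.2.2 (by grind)⟩
  have hsq : (s, q) ∈ M2 S a b := ⟨hsM, h.2.1, hS.mem_of_subset h.2.2 (by grind)⟩
  have e1 := hα p s hps (Or.inr fun hb => hp fun x hx => by have := hb hx; grind)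
  have e2 := hα s q hsq (Or.inr fun hb => hq fun x hx => by have := hb hx; grind)
  have e3 := hβ p s q hps h hsq (hS.mem_of_subset h.2.2 (by grind))
  linear_combination e1 + e2 - e3

lemma comp_mem_ZM (hS : IsSimplicialComplex S) (hab : Disjoint a b)
    {lam : {fg : Finset (Fin (n+1)) × Finset (Fin (n+1)) // fg ∈ N2 S a b} → ℂ}
    (hlam : lam ∈ ZN S a b) :
    (fun x : {pq : Finset (Fin (n+1)) × Finset (Fin (n+1)) // pq ∈ M2 S a b} =>
      lam ⟨((x.1.1 ∪ a) \ b, (x.1.2 ∪ a) \ b), pair_mem_N2_of_mem_M2 hS hab x.2⟩)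
      ∈ ZM S a b := by
  obtain ⟨hanti, hvan, hcoc⟩ := hlam
  refine ⟨fun p q _ _ => hanti _ _ _ _, fun p q h hc => ?_, fun p q r _ _ _ hu =>
    hcoc _ _ _ _ _ _ (hS.mem_of_subset hu (by grind))⟩
  have hbpq : ¬ b ⊆ p ∧ ¬ b ⊆ q := by
    rcases hc with hc | hc
    · exact ⟨fun hb => h.2.1.1 (hS.mem_of_subset hc (by grind)),
        fun hb => h.1.1 (hS.mem_of_subset hc (by grind))⟩
    · exact ⟨fun hb => hc (by grind), fun hb => hc (by grind)⟩
  exact hvan _ _ _ (mem_Ntilde_of_mem_Mab hS hab h.1 hbpq.1)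
    (mem_Ntilde_of_mem_Mab hS hab h.2.1 hbpq.2)

/-- Pullback of cocycles along `Φ`. -/
def pullbackZ (hS : IsSimplicialComplex S) (hab : Disjoint a b) : ZN S a b →ₗ[ℂ] ZM S a b where
  toFun lam := ⟨_, comp_mem_ZM hS hab lam.2⟩
  map_add' _ _ := rfl
  map_smul' _ _ := rfl

lemma pullbackZ_mem_BM (hS : IsSimplicialComplex S) (hab : Disjoint a b) {lam : ZN S a b}
    (hlam : lam ∈ BN S a b) : pullbackZ hS hab lam ∈ BM S a b := by
  classical
  obtain ⟨l, hl, hl'⟩ := hlam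
  refine ⟨fun p => if p ∈ Mab S a b then l ((p ∪ a) \ b) else 0, fun p hp => ?_, fun x => ?_⟩
  · by_cases hM : p ∈ Mab S a b
    · simp only [if_pos hM, hl _ (mem_Ntilde_of_mem_Mab hS hab hM hp)]
    · exact if_neg hM
  · simp only [if_pos x.2.1, if_pos x.2.2.1]
    exact hl' _

lemma mem_BN_of_pullbackZ_mem_BM (hS : IsSimplicialComplex S) (hab : Disjoint a b)
    {lam : ZN S a b} (hlam : pullbackZ hS hab lam ∈ BM S a b) : lam ∈ BN S a b := by
  obtain ⟨m, hm, hm'⟩ := hlam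
  have key : ∀ p q f g, ∀ hfg : (f, g) ∈ N2 S a b, p ∈ Mab S a b → q ∈ Mab S a b →
      (p ∪ a) \ b = f → (q ∪ a) \ b = g → lam.1 ⟨(f, g), hfg⟩ = m p - m q := by
    rintro p q _ _ hfg hp hq rfl rfl
    exact hm' ⟨(p, q), hp, hq, hS.mem_of_subset hfg.2.2 (by grind)⟩
  refine ⟨fun f => m (f ∪ b), fun f hf => ?_, fun x => ?_⟩
  · obtain ⟨r, hr⟩ := exists_lift S a b
    obtain ⟨hrM, hrf, hrb⟩ := hr f hf.1
    have hff : (f, f) ∈ N2 S a b := ⟨hf.1, hf.1, by simpa using hf.1.1⟩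
    have e := key (f ∪ b) (r f) f f hff (union_mem_Mab hf.1 subset_rfl hf.1.2.2.2) hrM
      (union_sdiff_eq_of_mem_Nab hf.1 subset_rfl) hrf
    rw [ZN.apply_self lam.2, hm _ (hrb hf)] at e
    linear_combination -e
  · obtain ⟨⟨f, g⟩, hfg⟩ := x
    exact key _ _ f g hfg (union_mem_Mab hfg.1 subset_rfl hfg.1.2.2.2)
      (union_mem_Mab hfg.2.1 subset_rfl hfg.2.1.2.2.2)
      (union_sdiff_eq_of_mem_Nab hfg.1 subset_rfl) (union_sdiff_eq_of_mem_Nab hfg.2.1 subset_rfl)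

lemma exists_sub_pullbackZ_mem_BM (hS : IsSimplicialComplex S) (hab : Disjoint a b)
    (μ : ZM S a b) : ∃ lam : ZN S a b, pullbackZ hS hab lam - μ ∈ BM S a b := by
  classical
  obtain ⟨r, hr⟩ := exists_lift S a b
  have hpair : ∀ f g, (f, g) ∈ N2 S a b → (r f, r g) ∈ M2 S a b := by
    intro f g h
    obtain ⟨hf, hf', -⟩ := hr f h.1
    obtain ⟨hg, hg', -⟩ := hr g h.2.1
    refine ⟨hf, hg, hS.mem_of_subset h.2.2 ?_⟩
    grind
  have hzero := @ZM.apply_eq_zero n S a b hS μ.1 μ.2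
  obtain ⟨hanti, -, hcoc⟩ := μ.2
  have hlam : (fun x : {fg : Finset (Fin (n+1)) × Finset (Fin (n+1)) // fg ∈ N2 S a b} =>
      μ.1 ⟨(r x.1.1, r x.1.2), hpair _ _ x.2⟩) ∈ ZN S a b := by
    refine ⟨fun f g _ _ => hanti _ _ _ _, fun f g h hf hg =>
      hzero _ ((hr f hf.1).2.2 hf) ((hr g hg.1).2.2 hg), fun f g h hfg hfh hgh hu =>
      hcoc _ _ _ _ _ _ (hS.mem_of_subset hu ?_)⟩
    have hf := (hr f hfg.1).2.1
    have hg := (hr g hfg.2.1).2.1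
    have hh := (hr h hfh.2.1).2.1
    grind
  have hfib : ∀ p ∈ Mab S a b, (r ((p ∪ a) \ b), p) ∈ M2 S a b := by
    intro p hp
    obtain ⟨h1, h2, -⟩ := hr _ (mem_Nab_of_mem_Mab hS hab hp)
    exact ⟨h1, hp, hS.mem_of_subset hp.2 (by grind)⟩
  refine ⟨⟨_, hlam⟩, fun p => if hp : p ∈ Mab S a b then μ.1 ⟨_, hfib p hp⟩ else 0,
    fun p hbp => ?_, ?_⟩
  · by_cases hp : p ∈ Mab S a b
    · simp only [dif_pos hp]
      have hN := mem_Ntilde_of_mem_Mab hS hab hp hbp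
      exact hzero _ ((hr _ hN.1).2.2 hN) hbp
    · exact dif_neg hp
  · rintro ⟨⟨p, q⟩, hpq⟩
    simp only [dif_pos hpq.1, dif_pos hpq.2.1]
    have hNp := mem_Nab_of_mem_Mab hS hab hpq.1
    have hNq := mem_Nab_of_mem_Mab hS hab hpq.2.1
    obtain ⟨hrp, hrp', -⟩ := hr _ hNp
    obtain ⟨hrq, hrq', -⟩ := hr _ hNq
    have hrr := hpair _ _ (pair_mem_N2_of_mem_M2 hS hab hpq)
    have hu := hpq.2.2
    simp only [union_union_sdiff] at hu
    have hpq' : (r ((p ∪ a) \ b), q) ∈ M2 S a b :=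
      ⟨hrp, hpq.2.1, by simpa only [union_union_sdiff, hrp'] using hu⟩
    have e1 := hcoc _ _ _ (hfib p hpq.1) hpq' hpq
      (by simpa only [union_union_sdiff, hrp', Finset.union_self] using hu)
    have e2 := hcoc _ _ _ hrr hpq' (hfib q hpq.2.1)
      (by
        rw [union_union_sdiff, union_union_sdiff, hrp', hrq', Finset.union_assoc, Finset.union_self]
        exact hu)
    change μ.1 ⟨_, hrr⟩ - μ.1 ⟨(p, q), hpq⟩ = _
    linear_combination e2 - e1

end Pullback

/-- pullback along `Φ`, `μ(p,q) := λ(Φ(p), Φ(q))`, is well defined on the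
cocycle level and induces a ℂ-linear isomorphism `V_N = Z_N/B_N → V_M = Z_M/B_M`. -/
theorem pullback_iso_on_T2 {n : ℕ} (S : Set (Finset (Fin (n+1))))
    (hS : IsSimplicialComplex S) (a b : Finset (Fin (n+1)))
    (hab : Disjoint a b) (hb : b ≠ ∅) :
    ∃ wd : ∀ x : {pq : Finset (Fin (n+1)) × Finset (Fin (n+1)) // pq ∈ M2 S a b},
        ((x.1.1 ∪ a) \ b, (x.1.2 ∪ a) \ b) ∈ N2 S a b,
    ∃ wd2 : ∀ lam : ZN S a b,
        (fun x : {pq : Finset (Fin (n+1)) × Finset (Fin (n+1)) // pq ∈ M2 S a b} =>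
          lam.1 ⟨((x.1.1 ∪ a) \ b, (x.1.2 ∪ a) \ b), wd x⟩) ∈ ZM S a b,
    ∃ e : (ZN S a b ⧸ BN S a b) ≃ₗ[ℂ] (ZM S a b ⧸ BM S a b),
      ∀ lam : ZN S a b,
        e (Submodule.Quotient.mk lam) = Submodule.Quotient.mk
          (⟨fun x => lam.1 ⟨((x.1.1 ∪ a) \ b, (x.1.2 ∪ a) \ b), wd x⟩, wd2 lam⟩ :
            ZM S a b) := by
  refine ⟨fun x => pair_mem_N2_of_mem_M2 hS hab x.2, fun lam => comp_mem_ZM hS hab lam.2, ?_⟩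
  refine ⟨LinearEquiv.ofBijective
    ((BN S a b).mapQ (BM S a b) (pullbackZ hS hab) fun _ => pullbackZ_mem_BM hS hab)
    ⟨?_, ?_⟩, fun _ => rfl⟩
  · rw [injective_iff_map_eq_zero]
    intro x
    obtain ⟨lam, rfl⟩ := Submodule.Quotient.mk_surjective _ x
    intro h
    rw [Submodule.mapQ_apply, Submodule.Quotient.mk_eq_zero] at h
    exact (Submodule.Quotient.mk_eq_zero _).mpr (mem_BN_of_pullbackZ_mem_BM hS hab h)
  · intro y
    obtain ⟨μ, rfl⟩ := Submodule.Quotient.mk_surjective _ y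
    obtain ⟨lam, h⟩ := exists_sub_pullbackZ_mem_BM hS hab μ
    exact ⟨Submodule.Quotient.mk lam, (Submodule.Quotient.eq _).mpr h⟩
end

section
/- Let X be a simplicial complex on [n] and a, b ⊆ [n] disjoint with b ≠ ∅. Let μ : M^{(2)}_{a−b} → ℂ be antisymmetric with μ(p,q) = 0 whenever (p ∩ q) ∪ ((p ∪ q ∪ a) ∖ b) ∈ X or b ⊄ p ∪ q, and μ(p,q) − μ(p,r) + μ(q,r) = 0 whenever p, q, r ∈ M_{a−b} with (p ∪ q ∪ r ∪ a) ∖ b ∈ X. If m, p ∈ M_{a−b} satisfy b ⊄ m, b ⊄ p, and Φ(p) ⊆ Φ(m), then (m, p) ∈ M^{(2)}_{a−b} and μ(m, p) = 0. -/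
/-- for an antisymmetric cochain `μ` on `M^{(2)}_{a−b}` satisfying the
Koszul vanishing condition and the cocycle condition, if `m, p ∈ M_{a−b}` with
`b ⊄ m`, `b ⊄ p` and `Φ(p) ⊆ Φ(m)`, then `(m,p) ∈ M^{(2)}_{a−b}` and `μ(m,p) = 0`. -/
theorem mu_vanishes_on_comparable {n : ℕ} (S : Set (Finset (Fin (n+1))))
    (hS : IsSimplicialComplex S) (a b : Finset (Fin (n+1))) (hab : Disjoint a b)
    (hb : b ≠ ∅)
    (μ : {pq : Finset (Fin (n+1)) × Finset (Fin (n+1)) // pq ∈ M2 S a b} → ℂ)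
    (hanti : ∀ p q (h : (p, q) ∈ M2 S a b) (h' : (q, p) ∈ M2 S a b),
      μ ⟨(p, q), h⟩ = - μ ⟨(q, p), h'⟩)
    (hvan : ∀ p q (h : (p, q) ∈ M2 S a b),
      ((p ∩ q) ∪ ((p ∪ q ∪ a) \ b) ∈ S ∨ ¬ b ⊆ p ∪ q) → μ ⟨(p, q), h⟩ = 0)
    (hcoc : ∀ p q r (hpq : (p, q) ∈ M2 S a b) (hpr : (p, r) ∈ M2 S a b)
      (hqr : (q, r) ∈ M2 S a b), (p ∪ q ∪ r ∪ a) \ b ∈ S →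
      μ ⟨(p, q), hpq⟩ - μ ⟨(p, r), hpr⟩ + μ ⟨(q, r), hqr⟩ = 0)
    (m p : Finset (Fin (n+1))) (hm : m ∈ Mab S a b) (hp : p ∈ Mab S a b)
    (hbm : ¬ b ⊆ m) (hbp : ¬ b ⊆ p) (hsub : (p ∪ a) \ b ⊆ (m ∪ a) \ b) :
    (m, p) ∈ M2 S a b ∧ ∀ h : (m, p) ∈ M2 S a b, μ ⟨(m, p), h⟩ = 0 := by
  obtain ⟨hmS, hmΦ⟩ := hm
  obtain ⟨hpS, hpΦ⟩ := hp
  have hΦ : (m ∪ p ∪ a) \ b = (m ∪ a) \ b := by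
    ext x
    have := @hsub x
    simp only [Finset.mem_sdiff, Finset.mem_union] at this ⊢
    tauto
  have hmp : (m, p) ∈ M2 S a b := ⟨⟨hmS, hmΦ⟩, ⟨hpS, hpΦ⟩, by rwa [hΦ]⟩
  refine ⟨hmp, fun h => ?_⟩
  by_cases hX : (m ∩ p) ∪ ((m ∪ p ∪ a) \ b) ∈ S
  · exact hvan m p h (Or.inl hX)
  rw [hΦ] at hX
  -- The non-face `q` agrees with `m ∩ p` on `b` and with `Φ(m)` off `b`.
  set q := (m ∩ p) ∪ ((m ∪ a) \ b) with hq
  have hqΦ : (q ∪ a) \ b = (m ∪ a) \ b := by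
    ext x
    simp only [hq, Finset.mem_sdiff, Finset.mem_union, Finset.mem_inter]
    tauto
  have hmqΦ : (m ∪ q ∪ a) \ b = (m ∪ a) \ b := by
    ext x
    simp only [hq, Finset.mem_sdiff, Finset.mem_union, Finset.mem_inter]
    tauto
  have hqpΦ : (q ∪ p ∪ a) \ b = (m ∪ a) \ b := by
    ext x
    have := @hsub x
    simp only [hq, Finset.mem_sdiff, Finset.mem_union, Finset.mem_inter] at this ⊢
    tauto
  have hmqpΦ : (m ∪ q ∪ p ∪ a) \ b = (m ∪ a) \ b := by
    ext x
    have := @hsub x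
    simp only [hq, Finset.mem_sdiff, Finset.mem_union, Finset.mem_inter] at this ⊢
    tauto
  have hqM : q ∈ Mab S a b := ⟨hX, by rwa [hqΦ]⟩
  have hmq : (m, q) ∈ M2 S a b := ⟨⟨hmS, hmΦ⟩, hqM, by rwa [hmqΦ]⟩
  have hqp : (q, p) ∈ M2 S a b := ⟨hqM, ⟨hpS, hpΦ⟩, by rwa [hqpΦ]⟩
  have hμmq : μ ⟨(m, q), hmq⟩ = 0 := by
    refine hvan m q hmq (Or.inr fun hsup => hbm fun x hx => ?_)
    have := hsup hx
    simp only [hq, Finset.mem_sdiff, Finset.mem_union, Finset.mem_inter] at this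
    tauto
  have hμqp : μ ⟨(q, p), hqp⟩ = 0 := by
    refine hvan q p hqp (Or.inr fun hsup => hbp fun x hx => ?_)
    have := hsup hx
    simp only [hq, Finset.mem_sdiff, Finset.mem_union, Finset.mem_inter] at this
    tauto
  have hδ := hcoc m q p hmq h hqp (by rwa [hmqpΦ])
  simpa [hμmq, hμqp] using hδ
end

section
/- Let X be a simplicial complex on [n], a, b ⊆ [n] disjoint with b ≠ ∅, and set N = N_{a−b}, Ñ = Ñ_{a−b} (both have property U). The restriction maps K^•(N) → K^•(Ñ) and C^•(N) → C^•(Ñ) are surjective morphisms of cochain complexes, and the restriction-to-flags maps induce a morphism of cochain complexes ker(K^•(N) → K^•(Ñ)) → ker(C^•(N) → C^•(Ñ)) which is a quasi-isomorphism, i.e., induces isomorphisms on cohomology in every degree. -/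
open scoped Classical

/-- Property U for `Y ⊆ X`. -/
def PropertyU {n : ℕ} (S Y : Set (Finset (Fin (n+1)))) : Prop :=
  Y ⊆ S ∧ ∀ f ∈ Y, ∀ g ∈ Y, f ∪ g ∈ S → f ∪ g ∈ Y

/-- The tuples `Y^{(k)} = {(f_0,…,f_k) ∈ Y^{k+1} : f_0 ∪ … ∪ f_k ∈ Y}` indexing the
cochain complex `K^•(Y)`. -/
def TupU {n : ℕ} (Y : Set (Finset (Fin (n+1)))) (k : ℕ) :
    Set (Fin (k+1) → Finset (Fin (n+1))) :=
  {f | (∀ i, f i ∈ Y) ∧ Finset.univ.sup f ∈ Y}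

/-- Flag tuples: pairwise distinct and pairwise comparable entries of `Y`; these index
the simplicial cochain complex `C^•(Y)` of the order complex `Y′`. -/
def TupFlag {n : ℕ} (Y : Set (Finset (Fin (n+1)))) (k : ℕ) :
    Set (Fin (k+1) → Finset (Fin (n+1))) :=
  {f | (∀ i, f i ∈ Y) ∧ Function.Injective f ∧ ∀ i j, f i ⊆ f j ∨ f j ⊆ f i}

/-- A cochain: an alternating function supported on the tuple set `T`
(functions on `T`, extended by zero to all tuples). -/
def IsAlt {n k : ℕ} (T : Set (Fin (k+1) → Finset (Fin (n+1))))
    (lam : (Fin (k+1) → Finset (Fin (n+1))) → ℂ) : Prop :=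
  (∀ f, f ∉ T → lam f = 0) ∧
  ∀ (f : Fin (k+1) → Finset (Fin (n+1))) (σ : Equiv.Perm (Fin (k+1))),
    lam (f ∘ σ) = ((Equiv.Perm.sign σ : ℤ) : ℂ) * lam f

/-- The simplicial codifferential `(dλ)(f_0,…,f_{k+1}) = Σ_v (−1)^v λ(f_0,…,f̂_v,…)`,
truncated to the tuple set `T'` of the target degree. -/
noncomputable def codiff {n k : ℕ} (T' : Set (Fin (k+2) → Finset (Fin (n+1))))
    (lam : (Fin (k+1) → Finset (Fin (n+1))) → ℂ) :
    (Fin (k+2) → Finset (Fin (n+1))) → ℂ :=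
  fun f => if f ∈ T' then
    ∑ v : Fin (k+2), (-1 : ℂ) ^ (v : ℕ) * lam (v.removeNth f) else 0

/-- Truncation (restriction followed by extension by zero) to a tuple set `T`. -/
noncomputable def truncTo {n k : ℕ} (T : Set (Fin (k+1) → Finset (Fin (n+1))))
    (lam : (Fin (k+1) → Finset (Fin (n+1))) → ℂ) :
    (Fin (k+1) → Finset (Fin (n+1))) → ℂ :=
  fun f => if f ∈ T then lam f else 0

/-- A cochain of the kernel complex `ker(K^•(Y) → K^•(Z))` (resp. of
`ker(C^•(Y) → C^•(Z))`): an alternating cochain supported on `T` (the tuples of `Y`)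
which vanishes on `Tz` (the tuples of `Z ⊆ Y`). -/
def KerAlt {n k : ℕ} (T Tz : Set (Fin (k+1) → Finset (Fin (n+1))))
    (lam : (Fin (k+1) → Finset (Fin (n+1))) → ℂ) : Prop :=
  IsAlt T lam ∧ ∀ f ∈ Tz, lam f = 0


section Cochains

variable {α : Type*} {m : ℕ}

/-- The untruncated simplicial coboundary on functions of `m`-tuples. -/
noncomputable def cobd (lam : (Fin m → α) → ℂ) : (Fin (m + 1) → α) → ℂ :=
  fun f => ∑ v : Fin (m + 1), (-1 : ℂ) ^ (v : ℕ) * lam (v.removeNth f)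

/-- Contraction of a cochain with a vertex, inserted in front. -/
def contr (u : α) (lam : (Fin (m + 1) → α) → ℂ) : (Fin m → α) → ℂ :=
  fun f => lam (Fin.cons u f)

def Alternates (lam : (Fin m → α) → ℂ) : Prop :=
  ∀ (f : Fin m → α) (σ : Equiv.Perm (Fin m)),
    lam (f ∘ σ) = ((Equiv.Perm.sign σ : ℤ) : ℂ) * lam f

lemma removeNth_succ_cons (v : Fin (m + 1)) (u : α) (f : Fin (m + 1) → α) :
    v.succ.removeNth (Fin.cons u f : Fin (m + 2) → α) = Fin.cons u (v.removeNth f) := by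
  rw [← Fin.cons_comp_succ_succAbove]; rfl

lemma cobd_sub (lam mu : (Fin m → α) → ℂ) : cobd (lam - mu) = cobd lam - cobd mu := by
  ext f
  simp [cobd, mul_sub, Finset.sum_sub_distrib]

lemma cobd_add (lam mu : (Fin m → α) → ℂ) : cobd (lam + mu) = cobd lam + cobd mu := by
  ext f
  simp [cobd, mul_add, Finset.sum_add_distrib]

lemma cobd_zero : cobd (0 : (Fin m → α) → ℂ) = 0 := by
  ext f
  simp [cobd]

lemma cobd_neg (lam : (Fin m → α) → ℂ) : cobd (-lam) = -cobd lam := by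
  simpa [cobd_zero] using cobd_sub 0 lam

lemma contr_sub (u : α) (lam mu : (Fin (m + 1) → α) → ℂ) :
    contr u (lam - mu) = contr u lam - contr u mu := rfl

lemma contr_cobd_zero (u : α) (lam : (Fin 0 → α) → ℂ) : contr u (cobd lam) = lam := by
  ext f
  simp [contr, cobd]

/-- Cartan-type formula: contraction with a vertex is a null homotopy of the identity. -/
lemma contr_cobd (u : α) (lam : (Fin (m + 1) → α) → ℂ) :
    contr u (cobd lam) = lam - cobd (contr u lam) := by
  ext f
  simp only [contr, cobd, Pi.sub_apply]
  rw [Fin.sum_univ_succ]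
  simp only [removeNth_succ_cons]
  simp [pow_succ, Finset.sum_neg_distrib, sub_eq_add_neg]

lemma ext_contr {lam mu : (Fin (m + 1) → α) → ℂ} (h : ∀ u, contr u lam = contr u mu) :
    lam = mu := by
  ext f
  rw [← Fin.cons_self_tail f]
  exact congrFun (h (f 0)) (Fin.tail f)

lemma cobd_cobd (lam : (Fin m → α) → ℂ) : cobd (cobd lam) = 0 := by
  induction m with
  | zero => exact ext_contr fun u => by rw [contr_cobd, contr_cobd_zero, sub_self]; rfl
  | succ m ih =>
    refine ext_contr fun u => ?_
    rw [contr_cobd, contr_cobd, cobd_sub, ih, sub_zero, sub_self]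
    rfl

lemma Alternates.of_adjacent {lam : (Fin (m + 1) → α) → ℂ}
    (h : ∀ (i : Fin m) f, lam (f ∘ Equiv.swap i.castSucc i.succ) = -lam f) :
    Alternates lam := by
  intro f σ
  have hσ : σ ∈ Submonoid.closure
      (Set.range fun i : Fin m => Equiv.swap i.castSucc i.succ) := by
    rw [Equiv.Perm.mclosure_swap_castSucc_succ]; trivial
  induction hσ using Submonoid.closure_induction generalizing f with
  | mem x hx =>
    obtain ⟨i, rfl⟩ := hx
    rw [h, Equiv.Perm.sign_swap (Fin.castSucc_lt_succ).ne]
    simp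
  | one => simp
  | mul x y _ _ hx hy =>
    have : f ∘ (x * y : Equiv.Perm _) = (f ∘ x) ∘ y := rfl
    rw [this, hy, hx, Equiv.Perm.sign_mul]
    push_cast
    ring

lemma Alternates.adjacent {lam : (Fin (m + 1) → α) → ℂ} (hl : Alternates lam)
    (i : Fin m) (f : Fin (m + 1) → α) :
    lam (f ∘ Equiv.swap i.castSucc i.succ) = -lam f := by
  rw [hl, Equiv.Perm.sign_swap (Fin.castSucc_lt_succ).ne]
  simp

lemma Alternates.contr {lam : (Fin (m + 1) → α) → ℂ} (hl : Alternates lam) (u : α) :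
    Alternates (contr u lam) := by
  intro f σ
  have h : (Fin.cons u (f ∘ σ) : Fin (m + 1) → α) =
      (Fin.cons u f : Fin (m + 1) → α) ∘ Equiv.Perm.decomposeFin.symm (0, σ) := by
    ext i
    refine Fin.cases ?_ (fun i => ?_) i <;> simp
  simp only [_root_.contr, h, hl _ (Equiv.Perm.decomposeFin.symm (0, σ))]
  simp

lemma Alternates.eq_zero {lam : (Fin m → α) → ℂ} (hl : Alternates lam) {f : Fin m → α}
    (hf : ¬ Function.Injective f) : lam f = 0 := by
  simp only [Function.Injective, not_forall] at hf
  obtain ⟨i, j, hij, hne⟩ := hf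
  have h := hl f (Equiv.swap i j)
  have h' : f ∘ Equiv.swap i j = f := by
    ext k
    simp only [Function.comp, Equiv.swap_apply_def]
    split_ifs <;> simp_all
  rw [h', Equiv.Perm.sign_swap hne] at h
  have h2 : lam f = -lam f := by simpa using h
  exact self_eq_neg.mp h2

lemma Alternates.sub {lam mu : (Fin m → α) → ℂ} (hl : Alternates lam) (hm : Alternates mu) :
    Alternates (lam - mu) := by
  intro f σ
  simp [hl f σ, hm f σ, mul_sub]

lemma Alternates.add {lam mu : (Fin m → α) → ℂ} (hl : Alternates lam) (hm : Alternates mu) :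
    Alternates (lam + mu) := by
  intro f σ
  simp [hl f σ, hm f σ, mul_add]

lemma Alternates.contr_contr {lam : (Fin (m + 2) → α) → ℂ} (hl : Alternates lam) (x y : α) :
    _root_.contr y (_root_.contr x lam) = -_root_.contr x (_root_.contr y lam) := by
  ext g
  simp only [_root_.contr, Pi.neg_apply]
  rw [← hl.adjacent 0]
  congr 1
  ext i
  refine Fin.cases ?_ (fun i => Fin.cases ?_ (fun i => ?_) i) i
  · simp
  · simp
  · rw [Function.comp, Equiv.swap_apply_of_ne_of_ne (by simp [Fin.ext_iff])
      (by simp [Fin.ext_iff])]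
    simp

lemma contr_contr_cobd (lam : (Fin (m + 1) → α) → ℂ) (hl : Alternates lam) (x y : α) :
    contr y (contr x (cobd lam)) = -contr x (contr y (cobd lam)) := by
  rw [contr_cobd, contr_cobd, contr_sub, contr_sub]
  cases m with
  | zero => rw [contr_cobd_zero, contr_cobd_zero, neg_sub]
  | succ m =>
    rw [contr_cobd, contr_cobd, hl.contr_contr x y, cobd_neg]
    abel

lemma Alternates.cobd {lam : (Fin m → α) → ℂ} (hl : Alternates lam) :
    Alternates (cobd lam) := by
  refine Alternates.of_adjacent fun i f => ?_
  induction m with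
  | zero => exact i.elim0
  | succ m ih =>
    rw [← Fin.cons_self_tail f]
    generalize f 0 = x
    generalize Fin.tail f = g
    refine Fin.cases ?_ (fun j => ?_) i
    · rw [← Fin.cons_self_tail g]
      generalize g 0 = y
      generalize Fin.tail g = g
      have h := congrFun (contr_contr_cobd lam hl y x) g
      simp only [_root_.contr, Pi.neg_apply] at h
      rw [← h]
      congr 1
      ext i
      refine Fin.cases ?_ (fun i => Fin.cases ?_ (fun i => ?_) i) i
      · simp
      · simp
      · rw [Function.comp, Equiv.swap_apply_of_ne_of_ne (by simp [Fin.ext_iff])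
          (by simp [Fin.ext_iff])]
        simp
    · have h : (Fin.cons x g : Fin (m + 2) → α) ∘ Equiv.swap j.succ.castSucc j.succ.succ =
          Fin.cons x (g ∘ Equiv.swap j.castSucc j.succ) := by
        ext i
        refine Fin.cases ?_ (fun i => ?_) i
        · rw [Function.comp, Equiv.swap_apply_of_ne_of_ne (by simp [Fin.ext_iff])
            (by simp [Fin.ext_iff])]
          simp
        · simp only [Function.comp, Fin.castSucc_succ, Fin.cons_succ]
          rw [(Fin.succ_injective _).swap_apply, Fin.cons_succ]
      have key : ∀ g', _root_.cobd lam (Fin.cons x g') =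
          lam g' - _root_.cobd (_root_.contr x lam) g' :=
        fun g' => congrFun (contr_cobd x lam) g'
      rw [h, key, key, hl.adjacent, ih (hl.contr x)]
      ring

lemma forall_mem_cons {Q : Set α} {u : α} {f : Fin m → α} (hu : u ∈ Q) (hf : ∀ i, f i ∈ Q) :
    ∀ i, (Fin.cons u f : Fin (m + 1) → α) i ∈ Q :=
  Fin.cases hu hf

lemma cobd_eq_zero {lam : (Fin m → α) → ℂ} {f : Fin (m + 1) → α}
    (h : ∀ v : Fin (m + 1), lam (v.removeNth f) = 0) : cobd lam f = 0 :=
  Finset.sum_eq_zero fun v _ => by rw [h, mul_zero]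

end Cochains

section Subdivision

variable {α : Type*} [SemilatticeSup α] [OrderBot α]

/-- The cochain map dual to barycentric subdivision followed by joins: the cone, with apex the
join of a tuple, over the subdivided boundary of the tuple. -/
noncomputable def subdiv : (m : ℕ) → ((Fin m → α) → ℂ) → (Fin m → α) → ℂ
  | 0, lam => lam
  | m + 1, lam => fun f => cobd (subdiv m (contr (Finset.univ.sup f) lam)) f

/-- The cochain homotopy between the identity and `subdiv`. -/
noncomputable def subdivHomotopy : (m : ℕ) → ((Fin (m + 1) → α) → ℂ) → (Fin m → α) → ℂ
  | 0, _ => 0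
  | m + 1, lam => fun f => contr (Finset.univ.sup f) lam f -
      cobd (subdivHomotopy m (contr (Finset.univ.sup f) lam)) f

variable {m : ℕ}

lemma subdiv_succ_apply (lam : (Fin (m + 1) → α) → ℂ) (f : Fin (m + 1) → α) :
    subdiv (m + 1) lam f = cobd (subdiv m (contr (Finset.univ.sup f) lam)) f := rfl

lemma subdivHomotopy_succ_apply (lam : (Fin (m + 2) → α) → ℂ) (f : Fin (m + 1) → α) :
    subdivHomotopy (m + 1) lam f = contr (Finset.univ.sup f) lam f -
      cobd (subdivHomotopy m (contr (Finset.univ.sup f) lam)) f := rfl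

lemma subdiv_sub (lam mu : (Fin m → α) → ℂ) :
    subdiv m (lam - mu) = subdiv m lam - subdiv m mu := by
  induction m with
  | zero => rfl
  | succ m ih =>
    ext f
    simp only [subdiv, contr_sub, ih, cobd_sub, Pi.sub_apply]

lemma subdiv_zero : subdiv m (0 : (Fin m → α) → ℂ) = 0 := by
  simpa using subdiv_sub (0 : (Fin m → α) → ℂ) 0

lemma subdivHomotopy_sub (lam mu : (Fin (m + 1) → α) → ℂ) :
    subdivHomotopy m (lam - mu) = subdivHomotopy m lam - subdivHomotopy m mu := by
  induction m with
  | zero => simp [subdivHomotopy]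
  | succ m ih =>
    ext f
    simp only [subdivHomotopy, contr_sub, ih, cobd_sub, Pi.sub_apply]
    ring

lemma cobd_subdivHomotopy (lam : (Fin (m + 1) → α) → ℂ) :
    cobd (subdivHomotopy m lam) + subdivHomotopy (m + 1) (cobd lam) =
      lam - subdiv (m + 1) lam := by
  induction m with
  | zero =>
    ext f
    simp [subdivHomotopy, subdiv, cobd_zero, contr_cobd]
  | succ m ih =>
    ext f
    have h := congrArg cobd (ih (contr (Finset.univ.sup f) lam))
    rw [cobd_add, cobd_cobd, zero_add, cobd_sub] at h
    rw [Pi.add_apply, subdivHomotopy_succ_apply (m := m + 1), contr_cobd, subdivHomotopy_sub,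
      cobd_sub, h]
    simp only [Pi.sub_apply, subdiv_succ_apply]
    ring

lemma cobd_subdiv (lam : (Fin (m + 1) → α) → ℂ) :
    subdiv (m + 2) (cobd lam) = cobd (subdiv (m + 1) lam) := by
  have h₁ := congrArg cobd (cobd_subdivHomotopy lam)
  have h₂ := cobd_subdivHomotopy (cobd lam)
  rw [cobd_add, cobd_cobd, zero_add, cobd_sub] at h₁
  rw [cobd_cobd, h₁] at h₂
  have h₀ : subdivHomotopy (m + 2) (0 : (Fin (m + 3) → α) → ℂ) = 0 := by
    simpa using subdivHomotopy_sub (0 : (Fin (m + 3) → α) → ℂ) 0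
  rw [h₀, add_zero] at h₂
  exact (sub_right_injective h₂).symm

lemma univ_sup_comp_perm (f : Fin m → α) (σ : Equiv.Perm (Fin m)) :
    Finset.univ.sup (f ∘ σ) = Finset.univ.sup f := by
  rw [← Finset.sup_image, Finset.image_univ_equiv]

lemma Alternates.subdiv {lam : (Fin m → α) → ℂ} (hl : Alternates lam) :
    Alternates (subdiv m lam) := by
  induction m with
  | zero => exact hl
  | succ m ih =>
    intro f σ
    simp only [_root_.subdiv, univ_sup_comp_perm]
    exact (ih (hl.contr _)).cobd f σ

lemma Alternates.subdivHomotopy {lam : (Fin (m + 1) → α) → ℂ} (hl : Alternates lam) :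
    Alternates (subdivHomotopy m lam) := by
  induction m with
  | zero => intro f σ; simp [_root_.subdivHomotopy]
  | succ m ih =>
    intro f σ
    simp only [_root_.subdivHomotopy, univ_sup_comp_perm]
    exact ((hl.contr _).sub (ih (hl.contr _)).cobd) f σ

lemma SupClosed.univ_sup_mem {Q : Set α} (hQ : SupClosed Q) {f : Fin (m + 1) → α}
    (hf : ∀ i, f i ∈ Q) : Finset.univ.sup f ∈ Q := by
  rw [← Finset.sup'_eq_sup Finset.univ_nonempty]
  exact hQ.finsetSup'_mem _ fun i _ => hf i

lemma subdivHomotopy_eq_zero {Q : Set α} (hQ : SupClosed Q)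
    {lam : (Fin (m + 1) → α) → ℂ} (hl : ∀ f, (∀ i, f i ∈ Q) → lam f = 0)
    {f : Fin m → α} (hf : ∀ i, f i ∈ Q) : subdivHomotopy m lam f = 0 := by
  induction m with
  | zero => rfl
  | succ m ih =>
    have hu := hQ.univ_sup_mem hf
    have hc : ∀ g : Fin (m + 1) → α, (∀ i, g i ∈ Q) →
        contr (Finset.univ.sup f) lam g = 0 := fun g hg => hl _ (forall_mem_cons hu hg)
    rw [subdivHomotopy_succ_apply, hc f hf, cobd_eq_zero fun v => ih hc fun i => hf _, sub_zero]

lemma subdiv_eq_zero {Q : Set α} (hQ : SupClosed Q)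
    {lam : (Fin m → α) → ℂ} (hl : ∀ f, (∀ i, f i ∈ Q) → Antitone f → lam f = 0)
    {f : Fin m → α} (hf : ∀ i, f i ∈ Q) : subdiv m lam f = 0 := by
  induction m generalizing Q with
  | zero => exact hl f hf fun i => i.elim0
  | succ m ih =>
    have hu := hQ.univ_sup_mem hf
    rw [subdiv_succ_apply]
    refine cobd_eq_zero fun v => ih (Q := Q ∩ Set.Iic (Finset.univ.sup f)) ?_ ?_ ?_
    · exact hQ.inter fun x hx y hy => sup_le hx hy
    · intro g hg hanti
      refine hl _ (forall_mem_cons hu fun i => (hg i).1) ?_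
      intro i
      refine Fin.cases ?_ (fun i => ?_) i
      · intro j _
        refine Fin.cases le_rfl (fun j => ?_) j
        simpa using (hg j).2
      · intro j
        refine Fin.cases (by simp) (fun j hij => ?_) j
        simpa using hanti (Fin.succ_le_succ_iff.mp hij)
    · exact fun i => ⟨hf _, Finset.le_sup (f := f) (Finset.mem_univ _)⟩

lemma univ_sup_cons_of_le {u : α} {g : Fin m → α} (hg : ∀ i, g i ≤ u) :
    Finset.univ.sup (Fin.cons u g : Fin (m + 1) → α) = u := by
  apply le_antisymm
  · exact Finset.sup_le fun i _ => Fin.cases (by simp) (by simpa using hg) i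
  · exact Finset.le_sup (f := (Fin.cons u g : Fin (m + 1) → α)) (Finset.mem_univ 0)

lemma exists_eq_univ_sup_of_total {f : Fin (m + 1) → α} (hf : ∀ i j, f i ≤ f j ∨ f j ≤ f i) :
    ∃ j, f j = Finset.univ.sup f := by
  have hr : SupClosed (Set.range f) := by
    rintro _ ⟨i, rfl⟩ _ ⟨j, rfl⟩
    rcases hf i j with h | h
    · exact ⟨j, (sup_eq_right.mpr h).symm⟩
    · exact ⟨i, (sup_eq_left.mpr h).symm⟩
  exact hr.univ_sup_mem fun i => ⟨i, rfl⟩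

/-- Subdivision does nothing to flags. -/
lemma subdiv_apply_of_total {lam : (Fin m → α) → ℂ} (hl : Alternates lam) {f : Fin m → α}
    (hf : ∀ i j, f i ≤ f j ∨ f j ≤ f i) : subdiv m lam f = lam f := by
  induction m with
  | zero => rfl
  | succ m ih =>
    obtain ⟨j, hj⟩ := exists_eq_univ_sup_of_total hf
    set σ := Equiv.swap 0 j
    suffices h : subdiv (m + 1) lam (f ∘ σ) = lam (f ∘ σ) by
      rw [hl.subdiv, hl] at h
      exact mul_left_cancel₀ (by exact_mod_cast (Equiv.Perm.sign σ).ne_zero) h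
    have hf' : ∀ i j, (f ∘ σ) i ≤ (f ∘ σ) j ∨ (f ∘ σ) j ≤ (f ∘ σ) i := fun i j => hf _ _
    have h0 : ∀ i, (f ∘ σ) i ≤ (f ∘ σ) 0 := fun i => by
      simp only [Function.comp, σ, Equiv.swap_apply_left, hj]
      exact Finset.le_sup (Finset.mem_univ _)
    generalize f ∘ σ = f at hf' h0
    rw [← Fin.cons_self_tail f]
    have hg : ∀ i, Fin.tail f i ≤ f 0 := fun i => h0 _
    have hg' : ∀ i j, Fin.tail f i ≤ Fin.tail f j ∨ Fin.tail f j ≤ Fin.tail f i :=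
      fun i j => hf' _ _
    generalize f 0 = u at hg
    generalize Fin.tail f = g at hg hg'
    rw [subdiv_succ_apply, univ_sup_cons_of_le hg]
    cases m with
    | zero => exact congrFun (contr_cobd_zero u _) g
    | succ m =>
      have h := congrFun (contr_cobd u (subdiv (m + 1) (contr u lam))) g
      refine h.trans ?_
      rw [Pi.sub_apply, ih (hl.contr u) hg', cobd_eq_zero, sub_zero]
      · rfl
      intro v
      have hcc : contr u (contr u lam) = 0 := by
        ext g
        exact hl.eq_zero fun hinj => by
          simpa [Fin.ext_iff] using @hinj 0 1 (by simp)
      rw [contr, subdiv_succ_apply, univ_sup_cons_of_le (g := v.removeNth g) fun i => hg _, hcc, subdiv_zero, cobd_zero]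
      rfl

end Subdivision

section Complexes

variable {n k : ℕ} {S Y Z : Set (Finset (Fin (n + 1)))}

lemma supClosed_below (hS : IsSimplicialComplex S) (hY : PropertyU S Y)
    {u : Finset (Fin (n + 1))} (hu : u ∈ Y) : SupClosed {g | g ∈ Y ∧ g ≤ u} :=
  fun g hg h hh =>
    ⟨hY.2 g hg.1 h hh.1 (hS.2 u (hY.1 hu) _ (Finset.union_subset hg.2 hh.2)),
      sup_le hg.2 hh.2⟩

lemma mem_TupU_of_le (hS : IsSimplicialComplex S) (hY : PropertyU S Y)
    {u : Finset (Fin (n + 1))} (hu : u ∈ Y) {g : Fin (k + 1) → Finset (Fin (n + 1))}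
    (hg : ∀ i, g i ∈ {g | g ∈ Y ∧ g ≤ u}) : g ∈ TupU Y k :=
  ⟨fun i => (hg i).1, ((supClosed_below hS hY hu).univ_sup_mem hg).1⟩

lemma forall_mem_below {f : Fin (k + 1) → Finset (Fin (n + 1))} (hf : f ∈ TupU Y k) (i) :
    f i ∈ {g | g ∈ Y ∧ g ≤ Finset.univ.sup f} :=
  ⟨hf.1 i, Finset.le_sup (Finset.mem_univ i)⟩

lemma removeNth_mem_TupU (hS : IsSimplicialComplex S) (hY : PropertyU S Y)
    {f : Fin (k + 2) → Finset (Fin (n + 1))} (hf : f ∈ TupU Y (k + 1)) (v : Fin (k + 2)) :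
    v.removeNth f ∈ TupU Y k :=
  mem_TupU_of_le hS hY hf.2 fun _ => forall_mem_below hf _

lemma removeNth_mem_TupFlag {f : Fin (k + 2) → Finset (Fin (n + 1))}
    (hf : f ∈ TupFlag Y (k + 1)) (v : Fin (k + 2)) : v.removeNth f ∈ TupFlag Y k :=
  ⟨fun _ => hf.1 _, hf.2.1.comp Fin.succAbove_right_injective, fun _ _ => hf.2.2 _ _⟩

lemma TupU_mono (hZY : Z ⊆ Y) : TupU Z k ⊆ TupU Y k :=
  fun _ hf => ⟨fun i => hZY (hf.1 i), hZY hf.2⟩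

lemma TupFlag_mono (hZY : Z ⊆ Y) : TupFlag Z k ⊆ TupFlag Y k :=
  fun _ hf => ⟨fun i => hZY (hf.1 i), hf.2⟩

lemma TupFlag_subset_TupU : TupFlag Y k ⊆ TupU Y k := fun f hf => by
  obtain ⟨j, hj⟩ := exists_eq_univ_sup_of_total hf.2.2
  exact ⟨hf.1, hj ▸ hf.1 j⟩

lemma comp_perm_mem_TupU {f : Fin (k + 1) → Finset (Fin (n + 1))} (hf : f ∈ TupU Y k)
    (σ : Equiv.Perm (Fin (k + 1))) : f ∘ σ ∈ TupU Y k :=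
  ⟨fun _ => hf.1 _, by rw [univ_sup_comp_perm]; exact hf.2⟩

lemma comp_perm_mem_TupFlag {f : Fin (k + 1) → Finset (Fin (n + 1))} (hf : f ∈ TupFlag Y k)
    (σ : Equiv.Perm (Fin (k + 1))) : f ∘ σ ∈ TupFlag Y k :=
  ⟨fun _ => hf.1 _, hf.2.1.comp σ.injective, fun _ _ => hf.2.2 _ _⟩

lemma truncTo_of_mem {T : Set (Fin (k + 1) → Finset (Fin (n + 1)))}
    {lam : (Fin (k + 1) → Finset (Fin (n + 1))) → ℂ} {f} (hf : f ∈ T) :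
    truncTo T lam f = lam f := if_pos hf

lemma truncTo_of_notMem {T : Set (Fin (k + 1) → Finset (Fin (n + 1)))}
    {lam : (Fin (k + 1) → Finset (Fin (n + 1))) → ℂ} {f} (hf : f ∉ T) :
    truncTo T lam f = 0 := if_neg hf

lemma codiff_of_mem {T : Set (Fin (k + 2) → Finset (Fin (n + 1)))}
    {lam : (Fin (k + 1) → Finset (Fin (n + 1))) → ℂ} {f} (hf : f ∈ T) :
    codiff T lam f = cobd lam f := if_pos hf

lemma codiff_of_notMem {T : Set (Fin (k + 2) → Finset (Fin (n + 1)))}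
    {lam : (Fin (k + 1) → Finset (Fin (n + 1))) → ℂ} {f} (hf : f ∉ T) :
    codiff T lam f = 0 := if_neg hf

lemma isAlt_truncTo {T : Set (Fin (k + 1) → Finset (Fin (n + 1)))}
    (hT : ∀ f ∈ T, ∀ σ : Equiv.Perm (Fin (k + 1)), f ∘ σ ∈ T)
    {lam : (Fin (k + 1) → Finset (Fin (n + 1))) → ℂ} (hl : Alternates lam) :
    IsAlt T (truncTo T lam) := by
  refine ⟨fun f hf => truncTo_of_notMem hf, fun f σ => ?_⟩
  by_cases hf : f ∈ T
  · rw [truncTo_of_mem hf, truncTo_of_mem (hT f hf σ), hl]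
  · have hf' : f ∘ σ ∉ T := fun h => hf <| by
      have h' := hT _ h σ⁻¹
      rwa [Function.comp_assoc, ← Equiv.Perm.coe_mul, mul_inv_cancel, Equiv.Perm.coe_one,
        Function.comp_id] at h'
    rw [truncTo_of_notMem hf, truncTo_of_notMem hf', mul_zero]

lemma IsAlt.truncTo_eq {T T' : Set (Fin (k + 1) → Finset (Fin (n + 1)))} (h : T ⊆ T')
    {lam : (Fin (k + 1) → Finset (Fin (n + 1))) → ℂ} (hl : IsAlt T lam) :
    truncTo T' lam = lam := by
  ext f
  by_cases hf : f ∈ T'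
  · exact truncTo_of_mem hf
  · rw [truncTo_of_notMem hf, hl.1 f fun h' => hf (h h')]

lemma exists_extension {T T' : Set (Fin (k + 1) → Finset (Fin (n + 1)))} (h : T ⊆ T')
    {mu : (Fin (k + 1) → Finset (Fin (n + 1))) → ℂ} (hm : IsAlt T mu) :
    ∃ lam, IsAlt T' lam ∧ truncTo T lam = mu :=
  ⟨mu, ⟨fun f hf => hm.1 f fun h' => hf (h h'), hm.2⟩, hm.truncTo_eq subset_rfl⟩

lemma codiff_truncTo {T : Set (Fin (k + 1) → Finset (Fin (n + 1)))}
    {T' : Set (Fin (k + 2) → Finset (Fin (n + 1)))}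
    (hT : ∀ f ∈ T', ∀ v : Fin (k + 2), v.removeNth f ∈ T)
    (lam : (Fin (k + 1) → Finset (Fin (n + 1))) → ℂ) :
    codiff T' (truncTo T lam) = codiff T' lam := by
  ext f
  by_cases hf : f ∈ T'
  · rw [codiff_of_mem hf, codiff_of_mem hf]
    exact Finset.sum_congr rfl fun v _ => by rw [truncTo_of_mem (hT f hf v)]
  · rw [codiff_of_notMem hf, codiff_of_notMem hf]

lemma truncTo_codiff {T : Set (Fin (k + 1) → Finset (Fin (n + 1)))}
    {T' T'' : Set (Fin (k + 2) → Finset (Fin (n + 1)))} (h : T' ⊆ T'')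
    (hT : ∀ f ∈ T', ∀ v : Fin (k + 2), v.removeNth f ∈ T)
    (lam : (Fin (k + 1) → Finset (Fin (n + 1))) → ℂ) :
    truncTo T' (codiff T'' lam) = codiff T' (truncTo T lam) := by
  rw [codiff_truncTo hT]
  ext f
  by_cases hf : f ∈ T'
  · rw [truncTo_of_mem hf, codiff_of_mem hf, codiff_of_mem (h hf)]
  · rw [truncTo_of_notMem hf, codiff_of_notMem hf]

lemma subdiv_eq_zero_of_flags (hS : IsSimplicialComplex S) (hY : PropertyU S Y)
    {lam : (Fin (k + 1) → Finset (Fin (n + 1))) → ℂ} (hl : Alternates lam)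
    (h0 : ∀ g ∈ TupFlag Y k, lam g = 0) {f : Fin (k + 1) → Finset (Fin (n + 1))}
    (hf : f ∈ TupU Y k) : subdiv (k + 1) lam f = 0 := by
  refine subdiv_eq_zero (supClosed_below hS hY hf.2) (fun g hg hanti => ?_)
    (forall_mem_below hf)
  by_cases hinj : Function.Injective g
  · exact h0 g ⟨fun i => (hg i).1, hinj, fun i j => (le_total j i).imp (@hanti _ _) (@hanti _ _)⟩
  · exact hl.eq_zero hinj

lemma subdivHomotopy_eq_zero_of_TupU (hS : IsSimplicialComplex S) (hY : PropertyU S Y)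
    {lam : (Fin (k + 2) → Finset (Fin (n + 1))) → ℂ}
    (h0 : ∀ g ∈ TupU Y (k + 1), lam g = 0) {f : Fin (k + 1) → Finset (Fin (n + 1))}
    (hf : f ∈ TupU Y k) : subdivHomotopy (k + 1) lam f = 0 :=
  subdivHomotopy_eq_zero (supClosed_below hS hY hf.2)
    (fun g hg => h0 g (mem_TupU_of_le hS hY hf.2 hg)) (forall_mem_below hf)

lemma kerAlt_truncTo_TupU (hZY : Z ⊆ Y) {lam : (Fin (k + 1) → Finset (Fin (n + 1))) → ℂ}
    (hl : Alternates lam) (h0 : ∀ f ∈ TupU Z k, lam f = 0) :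
    KerAlt (TupU Y k) (TupU Z k) (truncTo (TupU Y k) lam) :=
  ⟨isAlt_truncTo (fun _ hf σ => comp_perm_mem_TupU hf σ) hl,
    fun f hf => by rw [truncTo_of_mem (TupU_mono hZY hf), h0 f hf]⟩

lemma kerAlt_truncTo_TupFlag (hZY : Z ⊆ Y) {lam : (Fin (k + 1) → Finset (Fin (n + 1))) → ℂ}
    (hl : KerAlt (TupU Y k) (TupU Z k) lam) :
    KerAlt (TupFlag Y k) (TupFlag Z k) (truncTo (TupFlag Y k) lam) :=
  ⟨isAlt_truncTo (fun _ hf σ => comp_perm_mem_TupFlag hf σ) hl.1.2,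
    fun f hf => by
      rw [truncTo_of_mem (TupFlag_mono hZY hf), hl.2 f (TupFlag_subset_TupU hf)]⟩

/-- Every relative flag cocycle is the restriction of a relative cocycle. -/
lemma exists_cocycle_lift (hS : IsSimplicialComplex S) (hY : PropertyU S Y)
    (hZ : PropertyU S Z) (hZY : Z ⊆ Y) {mu : (Fin (k + 1) → Finset (Fin (n + 1))) → ℂ}
    (hm : KerAlt (TupFlag Y k) (TupFlag Z k) mu)
    (hd : codiff (TupFlag Y (k + 1)) mu = 0) :
    ∃ lam, KerAlt (TupU Y k) (TupU Z k) lam ∧ codiff (TupU Y (k + 1)) lam = 0 ∧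
      truncTo (TupFlag Y k) lam = mu := by
  have ha : Alternates mu := hm.1.2
  refine ⟨truncTo (TupU Y k) (subdiv (k + 1) mu), kerAlt_truncTo_TupU hZY ha.subdiv
    fun f hf => subdiv_eq_zero_of_flags hS hZ ha hm.2 hf, ?_, ?_⟩
  · rw [codiff_truncTo fun f hf v => removeNth_mem_TupU hS hY hf v]
    ext f
    by_cases hf : f ∈ TupU Y (k + 1)
    · rw [codiff_of_mem hf, ← cobd_subdiv]
      refine subdiv_eq_zero_of_flags hS hY ha.cobd (fun g hg => ?_) hf
      rw [← codiff_of_mem hg, hd]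
      rfl
    · exact codiff_of_notMem hf
  · ext f
    by_cases hf : f ∈ TupFlag Y k
    · rw [truncTo_of_mem hf, truncTo_of_mem (TupFlag_subset_TupU hf),
        subdiv_apply_of_total ha hf.2.2]
    · rw [truncTo_of_notMem hf, hm.1.1 f hf]

/-- A relative cocycle whose restriction to flags is a relative coboundary is one itself. -/
lemma exists_primitive (hS : IsSimplicialComplex S) (hY : PropertyU S Y)
    (hZ : PropertyU S Z) (hZY : Z ⊆ Y) {lam : (Fin (k + 2) → Finset (Fin (n + 1))) → ℂ}
    (hl : KerAlt (TupU Y (k + 1)) (TupU Z (k + 1)) lam)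
    (hd : codiff (TupU Y (k + 2)) lam = 0) {nu : (Fin (k + 1) → Finset (Fin (n + 1))) → ℂ}
    (hn : KerAlt (TupFlag Y k) (TupFlag Z k) nu)
    (h : truncTo (TupFlag Y (k + 1)) lam = codiff (TupFlag Y (k + 1)) nu) :
    ∃ rho, KerAlt (TupU Y k) (TupU Z k) rho ∧ lam = codiff (TupU Y (k + 1)) rho := by
  have hla : Alternates lam := hl.1.2
  have hna : Alternates nu := hn.1.2
  refine ⟨truncTo (TupU Y k) (subdivHomotopy (k + 1) lam + subdiv (k + 1) nu),
    kerAlt_truncTo_TupU hZY (hla.subdivHomotopy.add hna.subdiv) fun f hf => ?_, ?_⟩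
  · rw [Pi.add_apply, subdivHomotopy_eq_zero_of_TupU hS hZ hl.2 hf,
      subdiv_eq_zero_of_flags hS hZ hna hn.2 hf, add_zero]
  · rw [codiff_truncTo fun f hf v => removeNth_mem_TupU hS hY hf v]
    ext f
    by_cases hf : f ∈ TupU Y (k + 1)
    · have hhd : subdivHomotopy (k + 2) (cobd lam) f = 0 :=
        subdivHomotopy_eq_zero_of_TupU hS hY
          (fun g hg => by rw [← codiff_of_mem hg, hd]; rfl) hf
      have hsub : subdiv (k + 2) (lam - cobd nu) f = 0 := by
        refine subdiv_eq_zero_of_flags hS hY (hla.sub hna.cobd) (fun g hg => ?_) hf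
        have hg' := congrFun h g
        rw [truncTo_of_mem hg, codiff_of_mem hg] at hg'
        rw [Pi.sub_apply, hg', sub_self]
      have hom := congrFun (cobd_subdivHomotopy lam) f
      rw [subdiv_sub, cobd_subdiv] at hsub
      rw [codiff_of_mem hf, cobd_add]
      simp only [Pi.add_apply, Pi.sub_apply] at hom hsub ⊢
      linear_combination -hom + hhd + hsub
    · rw [codiff_of_notMem hf, hl.1.1 f hf]

lemma TupU_zero_subset_TupFlag : TupU Y 0 ⊆ TupFlag Y 0 := fun f hf =>
  have : Subsingleton (Fin (0 + 1)) := inferInstanceAs (Subsingleton (Fin 1))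
  ⟨hf.1, Function.injective_of_subsingleton f,
    fun i j => Or.inl (by rw [Subsingleton.elim i j])⟩

lemma propertyU_Nab (hS : IsSimplicialComplex S) (a b : Finset (Fin (n + 1))) :
    PropertyU S (Nab S a b) := by
  refine ⟨fun f hf => hf.1, fun f hf g hg h => ⟨h, ?_, ?_, fun hfg => hf.2.2.2 ?_⟩⟩
  · exact hf.2.1.trans Finset.subset_union_left
  · rw [Finset.union_inter_distrib_right, hf.2.2.1, hg.2.2.1, Finset.union_empty]
  · exact hS.2 _ hfg _ (Finset.union_subset_union_left Finset.subset_union_left)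

lemma propertyU_Ntilde (hS : IsSimplicialComplex S) (a b : Finset (Fin (n + 1))) :
    PropertyU S (Ntilde S a b) := by
  refine ⟨fun f hf => hf.1.1, fun f hf g hg h => ⟨(propertyU_Nab hS a b).2 f hf.1 g hg.1 h, ?_⟩⟩
  obtain ⟨b', hb', hfb⟩ := hf.2
  exact ⟨b', hb', fun hfg => hfb
    (hS.2 _ hfg _ (Finset.union_subset_union_left Finset.subset_union_left))⟩

lemma Ntilde_subset_Nab (a b : Finset (Fin (n + 1))) : Ntilde S a b ⊆ Nab S a b :=
  fun _ hf => hf.1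

end Complexes

/-- for `N = N_{a−b}` and `Ñ = Ñ_{a−b}` the restriction maps
`K^•(N) → K^•(Ñ)` and `C^•(N) → C^•(Ñ)` are surjective morphisms of cochain
complexes, and the restriction-to-flags map induces a morphism of cochain complexes
`ker(K^•(N) → K^•(Ñ)) → ker(C^•(N) → C^•(Ñ))` which is a quasi-isomorphism. -/
theorem kernel_complex_quasi_iso {n : ℕ} (S : Set (Finset (Fin (n+1))))
    (hS : IsSimplicialComplex S) (a b : Finset (Fin (n+1)))
    (hab : Disjoint a b) (hb : b ≠ ∅) :
    -- K^•(N) → K^•(Ñ) is a surjective morphism of cochain complexes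
    (∀ (k : ℕ) (lam : (Fin (k+1) → Finset (Fin (n+1))) → ℂ),
      IsAlt (TupU (Nab S a b) k) lam →
      truncTo (TupU (Ntilde S a b) (k+1)) (codiff (TupU (Nab S a b) (k+1)) lam) =
        codiff (TupU (Ntilde S a b) (k+1)) (truncTo (TupU (Ntilde S a b) k) lam)) ∧
    (∀ (k : ℕ) (mu : (Fin (k+1) → Finset (Fin (n+1))) → ℂ),
      IsAlt (TupU (Ntilde S a b) k) mu →
      ∃ lam, IsAlt (TupU (Nab S a b) k) lam ∧
        truncTo (TupU (Ntilde S a b) k) lam = mu) ∧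
    -- C^•(N) → C^•(Ñ) is a surjective morphism of cochain complexes
    (∀ (k : ℕ) (lam : (Fin (k+1) → Finset (Fin (n+1))) → ℂ),
      IsAlt (TupFlag (Nab S a b) k) lam →
      truncTo (TupFlag (Ntilde S a b) (k+1))
          (codiff (TupFlag (Nab S a b) (k+1)) lam) =
        codiff (TupFlag (Ntilde S a b) (k+1))
          (truncTo (TupFlag (Ntilde S a b) k) lam)) ∧
    (∀ (k : ℕ) (mu : (Fin (k+1) → Finset (Fin (n+1))) → ℂ),
      IsAlt (TupFlag (Ntilde S a b) k) mu →
      ∃ lam, IsAlt (TupFlag (Nab S a b) k) lam ∧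
        truncTo (TupFlag (Ntilde S a b) k) lam = mu) ∧
    -- restriction to flags maps the kernel complex into the kernel complex …
    (∀ (k : ℕ) (lam : (Fin (k+1) → Finset (Fin (n+1))) → ℂ),
      KerAlt (TupU (Nab S a b) k) (TupU (Ntilde S a b) k) lam →
      KerAlt (TupFlag (Nab S a b) k) (TupFlag (Ntilde S a b) k)
        (truncTo (TupFlag (Nab S a b) k) lam)) ∧
    -- … and is a morphism of cochain complexes
    (∀ (k : ℕ) (lam : (Fin (k+1) → Finset (Fin (n+1))) → ℂ),
      KerAlt (TupU (Nab S a b) k) (TupU (Ntilde S a b) k) lam →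
      truncTo (TupFlag (Nab S a b) (k+1)) (codiff (TupU (Nab S a b) (k+1)) lam) =
        codiff (TupFlag (Nab S a b) (k+1)) (truncTo (TupFlag (Nab S a b) k) lam)) ∧
    -- quasi-isomorphism: surjectivity on H^0
    (∀ mu : (Fin 1 → Finset (Fin (n+1))) → ℂ,
      KerAlt (TupFlag (Nab S a b) 0) (TupFlag (Ntilde S a b) 0) mu →
      codiff (TupFlag (Nab S a b) 1) mu = 0 →
      ∃ lam, KerAlt (TupU (Nab S a b) 0) (TupU (Ntilde S a b) 0) lam ∧
        codiff (TupU (Nab S a b) 1) lam = 0 ∧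
        truncTo (TupFlag (Nab S a b) 0) lam = mu) ∧
    -- injectivity on H^0
    (∀ lam : (Fin 1 → Finset (Fin (n+1))) → ℂ,
      KerAlt (TupU (Nab S a b) 0) (TupU (Ntilde S a b) 0) lam →
      codiff (TupU (Nab S a b) 1) lam = 0 →
      truncTo (TupFlag (Nab S a b) 0) lam = 0 → lam = 0) ∧
    -- surjectivity on H^{k+1}
    (∀ (k : ℕ) (mu : (Fin (k+2) → Finset (Fin (n+1))) → ℂ),
      KerAlt (TupFlag (Nab S a b) (k+1)) (TupFlag (Ntilde S a b) (k+1)) mu →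
      codiff (TupFlag (Nab S a b) (k+2)) mu = 0 →
      ∃ lam nu, KerAlt (TupU (Nab S a b) (k+1)) (TupU (Ntilde S a b) (k+1)) lam ∧
        codiff (TupU (Nab S a b) (k+2)) lam = 0 ∧
        KerAlt (TupFlag (Nab S a b) k) (TupFlag (Ntilde S a b) k) nu ∧
        truncTo (TupFlag (Nab S a b) (k+1)) lam =
          mu + codiff (TupFlag (Nab S a b) (k+1)) nu) ∧
    -- injectivity on H^{k+1}
    (∀ (k : ℕ) (lam : (Fin (k+2) → Finset (Fin (n+1))) → ℂ),
      KerAlt (TupU (Nab S a b) (k+1)) (TupU (Ntilde S a b) (k+1)) lam →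
      codiff (TupU (Nab S a b) (k+2)) lam = 0 →
      (∃ nu, KerAlt (TupFlag (Nab S a b) k) (TupFlag (Ntilde S a b) k) nu ∧
        truncTo (TupFlag (Nab S a b) (k+1)) lam =
          codiff (TupFlag (Nab S a b) (k+1)) nu) →
      ∃ rho, KerAlt (TupU (Nab S a b) k) (TupU (Ntilde S a b) k) rho ∧
        lam = codiff (TupU (Nab S a b) (k+1)) rho) := by
  have hN := propertyU_Nab hS a b
  have hNt := propertyU_Ntilde hS a b
  have hsub := Ntilde_subset_Nab (S := S) a b
  refine ⟨fun k lam _ => ?_, fun k mu hm => ?_, fun k lam _ => ?_, fun k mu hm => ?_,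
    fun k lam hl => kerAlt_truncTo_TupFlag hsub hl, fun k lam _ => ?_, fun mu hm hd => ?_,
    fun lam hl _ h0 => ?_, fun k mu hm hd => ?_, fun k lam hl hd ⟨nu, hn, h⟩ => ?_⟩
  · exact truncTo_codiff (TupU_mono hsub) (fun f hf v => removeNth_mem_TupU hS hNt hf v) lam
  · exact exists_extension (TupU_mono hsub) hm
  · exact truncTo_codiff (TupFlag_mono hsub) (fun f hf v => removeNth_mem_TupFlag hf v) lam
  · exact exists_extension (TupFlag_mono hsub) hm
  · exact truncTo_codiff TupFlag_subset_TupU (fun f hf v => removeNth_mem_TupFlag hf v) lam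
  · exact exists_cocycle_lift hS hN hNt hsub hm hd
  · rw [← hl.1.truncTo_eq TupU_zero_subset_TupFlag, h0]
  · obtain ⟨lam, hl, hdl, hr⟩ := exists_cocycle_lift hS hN hNt hsub hm hd
    refine ⟨lam, 0, hl, hdl, ⟨⟨fun _ _ => rfl, fun _ _ => by simp⟩, fun _ _ => rfl⟩, ?_⟩
    ext f
    simp [hr, codiff]
  · exact exists_primitive hS hN hNt hsub hl hd hn h
end
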